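/- arXiv:2002.07830 — 3 statements merged into one kernel-verified Lean document; each statement's English description precedes it below -/
import Mathlib

section
/- Let U ⊆ ℂ^{d} × ℂ be open with coordinates (z, w), fix a positive integer n, and let φ : U → ℝ be a smooth plurisubharmonic function of the form φ(z, w) = Σ_{p+q=n, p,q≥0} φ^{(p,q)}(z)·w^p·conj(w)^q + O(|w|^{n+1}), with the φ^{(p,q)} smooth. If n = 2m is even, then the coefficient function φ^{(m,m)}(z) is a plurisubharmonic function of z on the slice {w = 0}, and φ^{(m,m)}(z) ≥ 0 for all z. -/
open Complex

/-- Wirtinger derivative `∂_v f` of `f : E → ℂ` at `z` in the direction `v`. -/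
noncomputable def wDeriv {E : Type*} [NormedAddCommGroup E] [NormedSpace ℂ E]
    (f : E → ℂ) (z v : E) : ℂ :=
  (fderiv ℝ f z v - Complex.I * fderiv ℝ f z (Complex.I • v)) / 2

/-- Conjugate Wirtinger derivative `∂̄_v f` of `f : E → ℂ` at `z` in the direction `v`. -/
noncomputable def wBarDeriv {E : Type*} [NormedAddCommGroup E] [NormedSpace ℂ E]
    (f : E → ℂ) (z v : E) : ℂ :=
  (fderiv ℝ f z v + Complex.I * fderiv ℝ f z (Complex.I • v)) / 2

/-- Complex Hessian `∂_v ∂̄_w f` of `f : E → ℂ` at `z`;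
for `E = ℂ^d` this is `∑_{ν,μ} v_ν conj(w_μ) ∂²f/∂z_ν ∂conj(z_μ)`. -/
noncomputable def cHess {E : Type*} [NormedAddCommGroup E] [NormedSpace ℂ E]
    (f : E → ℂ) (z v w : E) : ℂ :=
  wDeriv (fun x => wBarDeriv f x w) z v

/-- A smooth real function is plurisubharmonic on `U` iff its complex Hessian is
positive semi-definite at every point of `U`. -/
def PSHOn {E : Type*} [NormedAddCommGroup E] [NormedSpace ℂ E]
    (φ : E → ℝ) (U : Set E) : Prop :=
  ∀ z ∈ U, ∀ v : E, 0 ≤ (cHess (fun x => (φ x : ℂ)) z v v).re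

/-- Second derivative of `f` at `x` along the real line in direction `v`. -/
noncomputable def lineD2 {E : Type*} [NormedAddCommGroup E] [NormedSpace ℂ E]
    (f : E → ℝ) (x v : E) : ℝ :=
  iteratedDeriv 2 (fun t : ℝ => f (x + (t : ℂ) • v)) 0

/-- Laplacian of `f` at `x` along the complex line in direction `v`. -/
noncomputable def lineLap {E : Type*} [NormedAddCommGroup E] [NormedSpace ℂ E]
    (f : E → ℝ) (x v : E) : ℝ :=
  lineD2 f x v + lineD2 f x (Complex.I • v)

lemma contDiff_line {E : Type*} [NormedAddCommGroup E] [NormedSpace ℂ E] (x v : E) :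
    ContDiff ℝ 2 (fun t : ℝ => x + (t : ℂ) • v) := by
  have h : (fun t : ℝ => x + (t : ℂ) • v) = fun t : ℝ => x + t • v := by
    funext t
    rw [Complex.coe_smul]
  rw [h]
  fun_prop

lemma contDiffAt_line {E : Type*} [NormedAddCommGroup E] [NormedSpace ℂ E]
    {f : E → ℝ} {x : E} (hf : ContDiffAt ℝ 2 f x) (v : E) :
    ContDiffAt ℝ 2 (fun t : ℝ => f (x + (t : ℂ) • v)) 0 := by
  have h2 : ContDiffAt ℝ 2 f ((fun t : ℝ => x + (t : ℂ) • v) 0) := by simpa using hf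
  exact h2.comp (0 : ℝ) (contDiff_line x v).contDiffAt

lemma lineD2_eq {E : Type*} [NormedAddCommGroup E] [NormedSpace ℂ E]
    {f : E → ℝ} {x : E} (hf : ContDiffAt ℝ 2 f x) (v : E) :
    lineD2 f x v = fderiv ℝ (fun y => fderiv ℝ f y v) x v := by
  unfold lineD2
  have hline : ∀ t : ℝ, HasDerivAt (fun t : ℝ => x + (t : ℂ) • v) v t := by
    intro t
    have h : (fun t : ℝ => x + (t : ℂ) • v) = fun t : ℝ => x + t • v := by
      funext t
      rw [Complex.coe_smul]
    rw [h]
    simpa using ((hasDerivAt_id t).smul_const v).const_add x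
  have hev : ∀ᶠ y in nhds x, DifferentiableAt ℝ f y := by
    filter_upwards [hf.eventually (by simp)] with y hy
    exact hy.differentiableAt (by simp)
  have hcont : Filter.Tendsto (fun t : ℝ => x + (t : ℂ) • v) (nhds 0) (nhds x) := by
    have := (hline 0).continuousAt.tendsto
    simpa using this
  have h1 : deriv (fun t : ℝ => f (x + (t : ℂ) • v)) =ᶠ[nhds 0]
      fun t : ℝ => fderiv ℝ f (x + (t : ℂ) • v) v := by
    filter_upwards [hcont.eventually hev] with t ht
    exact (ht.hasFDerivAt.comp_hasDerivAt t (hline t)).deriv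
  rw [iteratedDeriv_succ, iteratedDeriv_one, h1.deriv_eq]
  have hd : DifferentiableAt ℝ (fun y => fderiv ℝ f y v) x := by
    have : DifferentiableAt ℝ (fderiv ℝ f) x :=
      (hf.fderiv_right (m := 1) (by norm_num)).differentiableAt (by simp)
    exact this.clm_apply (differentiableAt_const v)
  have hd' : HasFDerivAt (fun y => fderiv ℝ f y v) (fderiv ℝ (fun y => fderiv ℝ f y v) x)
      (x + ((0 : ℝ) : ℂ) • v) := by simpa using hd.hasFDerivAt
  exact (hd'.comp_hasDerivAt (0 : ℝ) (hline 0)).deriv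

lemma cHess_re_eq {E : Type*} [NormedAddCommGroup E] [NormedSpace ℂ E]
    {f : E → ℝ} {x : E} (hf : ContDiffAt ℝ 2 f x) (v : E) :
    (cHess (fun y => (f y : ℂ)) x v v).re = lineLap f x v / 4 := by
  have hev : ∀ᶠ y in nhds x, DifferentiableAt ℝ f y := by
    filter_upwards [hf.eventually (by simp)] with y hy
    exact hy.differentiableAt (by simp)
  have hdd : ∀ u : E, DifferentiableAt ℝ (fun y => fderiv ℝ f y u) x := by
    intro u
    have : DifferentiableAt ℝ (fderiv ℝ f) x :=
      (hf.fderiv_right (m := 1) (by norm_num)).differentiableAt (by simp)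
    exact this.clm_apply (differentiableAt_const u)
  have hof : ∀ (g : E → ℝ) (y : E), DifferentiableAt ℝ g y →
      HasFDerivAt (fun y => (g y : ℂ)) (Complex.ofRealCLM.comp (fderiv ℝ g y)) y := by
    intro g y hg
    exact Complex.ofRealCLM.hasFDerivAt.comp y hg.hasFDerivAt
  have h1 : (fun y => wBarDeriv (fun y => (f y : ℂ)) y v) =ᶠ[nhds x]
      fun y => ((fderiv ℝ f y v : ℝ) : ℂ) * (1 / 2) +
        ((fderiv ℝ f y (Complex.I • v) : ℝ) : ℂ) * (Complex.I / 2) := by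
    filter_upwards [hev] with y hy
    simp only [wBarDeriv, (hof f y hy).fderiv]
    simp
    ring
  have h2 := ((hof _ x (hdd v)).mul_const (1 / 2 : ℂ)).add
    ((hof _ x (hdd (Complex.I • v))).mul_const (Complex.I / 2 : ℂ))
  have h3 := h2.congr_of_eventuallyEq h1
  simp only [cHess, wDeriv, h3.fderiv, lineLap, lineD2_eq hf]
  simp
  ring

lemma second_deriv_test {h : ℝ → ℝ} (hc : ContDiffAt ℝ 2 h 0) (hm : IsLocalMax h 0) :
    iteratedDeriv 2 h 0 ≤ 0 := by
  rw [iteratedDeriv_succ, iteratedDeriv_one]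
  by_contra! hpos
  have hmin := isLocalMin_of_deriv_deriv_pos hpos hm.deriv_eq_zero hc.continuousAt
  have heq : h =ᶠ[nhds 0] fun _ => h 0 := by
    filter_upwards [hm, hmin] with t h1 h2
    exact le_antisymm h1 h2
  have : deriv (deriv h) 0 = 0 := by
    rw [heq.deriv.deriv_eq]
    simp
  linarith

lemma quad_d2 (a b c : ℝ) : iteratedDeriv 2 (fun t : ℝ => a + b * t + c * t ^ 2) 0 = 2 * c := by
  rw [iteratedDeriv_succ, iteratedDeriv_one]
  have h1 : ∀ t : ℝ, HasDerivAt (fun t : ℝ => a + b * t + c * t ^ 2) (b + 2 * c * t) t := by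
    intro t
    have := (((hasDerivAt_id t).const_mul b).const_add a).add
      (((hasDerivAt_id t).pow 2).const_mul c)
    refine this.congr_deriv ?_
    norm_num
    ring
  have h2 : deriv (fun t : ℝ => a + b * t + c * t ^ 2) = fun t => b + 2 * c * t :=
    funext fun t => (h1 t).deriv
  rw [h2]
  have := ((hasDerivAt_id (0 : ℝ)).const_mul (2 * c)).const_add b
  simpa using this.deriv

lemma max_principle {E : Type*} [NormedAddCommGroup E] [NormedSpace ℂ E]
    (F : E → ℝ) (x v : E) (r κ M : ℝ) (hr : 0 < r)
    (hC : ∀ l : ℂ, ‖l‖ ≤ r → ContDiffAt ℝ 2 F (x + l • v))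
    (hS : ∀ l : ℂ, ‖l‖ < r → -(4 * κ) < lineLap F (x + l • v) v)
    (hM : ∀ l : ℂ, ‖l‖ = r → F (x + l • v) ≤ M) : F x ≤ M + κ * r ^ 2 := by
  let g : ℂ → ℝ := fun l => F (x + l • v) + κ * ‖l‖ ^ 2
  have hg : ContinuousOn g (Metric.closedBall 0 r) := by
    intro l hl
    have h1 : ContinuousAt (fun l : ℂ => F (x + l • v)) l := by
      have := (hC l (by simpa using hl)).continuousAt
      exact ContinuousAt.comp (f := fun l : ℂ => x + l • v) this (by fun_prop)
    exact (h1.add (by fun_prop)).continuousWithinAt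
  obtain ⟨l, hl, hmax⟩ := (isCompact_closedBall (0 : ℂ) r).exists_isMaxOn
    ⟨0, by simp [hr.le]⟩ hg
  have hl' : ‖l‖ ≤ r := by simpa using hl
  have h0 : g 0 ≤ g l := hmax (by simp [hr.le])
  have hg0 : g 0 = F x := by simp [g]
  rcases hl'.eq_or_lt with he | hlt
  · have := hM l he
    simp only [g, he] at h0
    rw [← hg0]
    simp only [g]
    linarith
  · exfalso
    have hloc : IsLocalMax g l :=
      hmax.isLocalMax (Metric.closedBall_mem_nhds_of_mem (by simpa using hlt))
    have key : ∀ u : ℂ, ‖u‖ = 1 → lineD2 F (x + l • v) (u • v) + 2 * κ ≤ 0 := by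
      intro u hu
      have hcd := contDiffAt_line (hC l hl') (u • v)
      set b := 2 * (l.re * u.re + l.im * u.im) with hb
      have hq : ContDiffAt ℝ 2 (fun t : ℝ => κ * ‖l‖ ^ 2 + κ * b * t + κ * t ^ 2) 0 := by
        fun_prop
      have hgl : (fun t : ℝ => F (x + l • v + (t : ℂ) • u • v) +
          (κ * ‖l‖ ^ 2 + κ * b * t + κ * t ^ 2)) = fun t : ℝ => g (l + t * u) := by
        funext t
        have hu2 : u.re * u.re + u.im * u.im = 1 := by
          rw [← Complex.normSq_apply, Complex.normSq_eq_norm_sq, hu]; norm_num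
        simp only [g, ← Complex.normSq_eq_norm_sq, Complex.normSq_apply, hb]
        rw [add_smul, mul_smul, add_assoc]
        simp
        linear_combination (-κ * t ^ 2) * hu2
      have hlm : IsLocalMax (fun t : ℝ => g (l + t * u)) 0 := by
        have hct : Filter.Tendsto (fun t : ℝ => l + (t : ℂ) * u) (nhds 0) (nhds l) := by
          have : ContinuousAt (fun t : ℝ => l + (t : ℂ) * u) 0 := by fun_prop
          simpa using this.tendsto
        have := hct.eventually hloc
        filter_upwards [this] with t ht
        simpa using ht
      rw [← hgl] at hlm
      have := second_deriv_test (hcd.add hq) hlm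
      rw [iteratedDeriv_fun_add hcd hq, quad_d2] at this
      exact this
    have k1 := key 1 (by simp)
    have k2 := key Complex.I (by simp)
    have := hS l hlt
    rw [one_smul] at k1
    simp only [lineLap] at this
    linarith

lemma lineLap_sub {E : Type*} [NormedAddCommGroup E] [NormedSpace ℂ E]
    {f g : E → ℝ} {x : E} (hf : ContDiffAt ℝ 2 f x) (hg : ContDiffAt ℝ 2 g x) (v : E) :
    lineLap (fun y => f y - g y) x v = lineLap f x v - lineLap g x v := by
  unfold lineLap lineD2
  rw [iteratedDeriv_fun_sub (contDiffAt_line hf v) (contDiffAt_line hg v),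
    iteratedDeriv_fun_sub (contDiffAt_line hf _) (contDiffAt_line hg _)]
  ring

lemma lineLap_const_mul {E : Type*} [NormedAddCommGroup E] [NormedSpace ℂ E]
    {f : E → ℝ} {x : E} (c : ℝ) (v : E) :
    lineLap (fun y => c * f y) x v = c * lineLap f x v := by
  unfold lineLap lineD2
  rw [iteratedDeriv_const_mul_field, iteratedDeriv_const_mul_field]
  ring

lemma lineLap_sum {E : Type*} [NormedAddCommGroup E] [NormedSpace ℂ E]
    {N : ℕ} {f : ℕ → E → ℝ} {x : E} (hf : ∀ k, ContDiffAt ℝ 2 (f k) x) (v : E) :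
    lineLap (fun y => ∑ k ∈ Finset.range N, f k y) x v
      = ∑ k ∈ Finset.range N, lineLap (f k) x v := by
  unfold lineLap lineD2
  rw [iteratedDeriv_fun_sum (fun k _ => contDiffAt_line (hf k) v),
    iteratedDeriv_fun_sum (fun k _ => contDiffAt_line (hf k) _), Finset.sum_add_distrib]

lemma root_sum (m : ℕ) (ζ : ℂ) (hζ : IsPrimitiveRoot ζ (2 * m + 1)) (a : ℕ → ℂ) (w : ℂ) :
    ∑ k ∈ Finset.range (2 * m + 1), ∑ p ∈ Finset.range (2 * m + 1),
      a p * (ζ ^ k * w) ^ p * (starRingEnd ℂ (ζ ^ k * w)) ^ (2 * m - p)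
    = (2 * m + 1 : ℂ) * (a m * (‖w‖ : ℂ) ^ (2 * m)) := by
  have hn : ‖ζ‖ = 1 := hζ.norm'_eq_one (by omega)
  have hcz : ζ * starRingEnd ℂ ζ = 1 := by
    rw [Complex.mul_conj, Complex.normSq_eq_norm_sq, hn]; norm_num
  rw [Finset.sum_comm]
  have hterm : ∀ p ∈ Finset.range (2 * m + 1), ∑ k ∈ Finset.range (2 * m + 1),
      a p * (ζ ^ k * w) ^ p * (starRingEnd ℂ (ζ ^ k * w)) ^ (2 * m - p) =
      if p = m then (2 * m + 1 : ℂ) * (a m * (‖w‖ : ℂ) ^ (2 * m)) else 0 := by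
    intro p hp
    have hp' : p < 2 * m + 1 := Finset.mem_range.mp hp
    have hfac : ∀ k ∈ Finset.range (2 * m + 1),
        a p * (ζ ^ k * w) ^ p * (starRingEnd ℂ (ζ ^ k * w)) ^ (2 * m - p) =
        (a p * w ^ p * (starRingEnd ℂ w) ^ (2 * m - p)) *
          (ζ ^ p * (starRingEnd ℂ ζ) ^ (2 * m - p)) ^ k := by
      intro k _
      simp only [map_mul, map_pow, mul_pow, ← pow_mul, mul_comm k]
      ring
    rw [Finset.sum_congr rfl hfac, ← Finset.mul_sum]
    set ξ := ζ ^ p * (starRingEnd ℂ ζ) ^ (2 * m - p) with hξ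
    split_ifs with h
    · subst h
      have e : 2 * p - p = p := by omega
      have h1 : ξ = 1 := by rw [hξ, e, ← mul_pow, hcz, one_pow]
      have h2 : w ^ p * (starRingEnd ℂ w) ^ p = (‖w‖ : ℂ) ^ (2 * p) := by
        rw [← mul_pow, Complex.mul_conj, Complex.normSq_eq_norm_sq, pow_mul]; norm_num
      rw [h1, e, mul_assoc (a p), h2]
      simp
      ring
    · have hz1 : ζ ^ (2 * m + 1) = 1 := hζ.pow_eq_one
      have hc1 : (starRingEnd ℂ ζ) ^ (2 * m + 1) = 1 := by rw [← map_pow, hz1, map_one]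
      have hN : ξ ^ (2 * m + 1) = 1 := by
        rw [hξ, mul_pow, ← pow_mul, ← pow_mul, mul_comm p, mul_comm (2 * m - p), pow_mul,
          pow_mul, hz1, hc1, one_pow, one_pow, one_mul]
      have hne : ξ ≠ 1 := by
        intro h1
        have h3 : ζ ^ (2 * p + 1) = 1 := by
          have e : ζ ^ (2 * m + 1) * ζ ^ p = ζ ^ (2 * p + 1) * ζ ^ (2 * m - p) := by
            rw [← pow_add, ← pow_add]; congr 1; omega
          rw [hz1, one_mul] at e
          have : ξ = ζ ^ (2 * p + 1) := by
            rw [hξ, e, mul_assoc, ← mul_pow, hcz, one_pow, mul_one]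
          rw [← this, h1]
        obtain ⟨c, hc⟩ := (hζ.pow_eq_one_iff_dvd _).mp h3
        have hc2 : c < 2 := by
          by_contra! hh
          have := Nat.mul_le_mul_left (2 * m + 1) hh
          omega
        interval_cases c <;> omega
      rw [geom_sum_eq hne, hN]
      simp
  rw [Finset.sum_congr rfl hterm]
  simp
  intro h
  omega

lemma avg_exists {d : ℕ} (U : Set ((Fin d → ℂ) × ℂ)) (hU : IsOpen U)
    (m : ℕ)
    (φ : (Fin d → ℂ) × ℂ → ℝ) (hsm : ContDiffOn ℝ (⊤ : ℕ∞) φ U) (hpsh : PSHOn φ U)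
    (φc : ℕ → (Fin d → ℂ) → ℂ) (z₀ : Fin d → ℂ) (hz₀ : (z₀, (0 : ℂ)) ∈ U)
    (hexp : ∃ C > (0 : ℝ), ∃ r > (0 : ℝ), ∀ (z : Fin d → ℂ) (w : ℂ),
        ‖z - z₀‖ < r → ‖w‖ < r → (z, w) ∈ U →
        ‖(φ (z, w) : ℂ) - ∑ p ∈ Finset.range (2 * m + 1),
            φc p z * w ^ p * (starRingEnd ℂ w) ^ (2 * m - p)‖ ≤ C * ‖w‖ ^ (2 * m + 1)) :
    ∃ A : (Fin d → ℂ) × ℂ → ℝ, ∃ r > (0 : ℝ), ∃ C > (0 : ℝ), ∀ (z : Fin d → ℂ) (w : ℂ),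
      ‖z - z₀‖ < r → ‖w‖ < r → ContDiffAt ℝ 2 A (z, w) ∧ (∀ v, 0 ≤ lineLap A (z, w) v) ∧
      ‖(A (z, w) : ℂ) - φc m z * (‖w‖ : ℂ) ^ (2 * m)‖ ≤ C * ‖w‖ ^ (2 * m + 1) := by
  obtain ⟨C, hC, r₁, hr₁, hb⟩ := hexp
  obtain ⟨r₂, hr₂, hball⟩ := Metric.isOpen_iff.mp hU _ hz₀
  have hmem : ∀ (z : Fin d → ℂ) (w : ℂ), ‖z - z₀‖ < r₂ → ‖w‖ < r₂ → (z, w) ∈ U := by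
    intro z w hz hw
    apply hball
    rw [Metric.mem_ball, Prod.dist_eq, max_lt_iff]
    exact ⟨by simpa [dist_eq_norm] using hz, by simpa using hw⟩
  have hφ : ∀ x ∈ U, ContDiffAt ℝ 2 φ x := fun x hx =>
    (hsm.contDiffAt (hU.mem_nhds hx)).of_le (WithTop.coe_le_coe.mpr (le_top : (2 : ℕ∞) ≤ ⊤))
  let ζ : ℂ := Complex.exp (2 * Real.pi * Complex.I / ((2 * m + 1 : ℕ) : ℂ))
  have hζ : IsPrimitiveRoot ζ (2 * m + 1) := Complex.isPrimitiveRoot_exp _ (by omega)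
  have hn : ‖ζ‖ = 1 := hζ.norm'_eq_one (by omega)
  have hnk : ∀ (k : ℕ) (w : ℂ), ‖ζ ^ k * w‖ = ‖w‖ := by
    intro k w
    rw [norm_mul, norm_pow, hn, one_pow, one_mul]
  have hNpos : (0 : ℝ) < 2 * m + 1 := by positivity
  refine ⟨fun x => (2 * m + 1 : ℝ)⁻¹ * ∑ k ∈ Finset.range (2 * m + 1), φ (x.1, ζ ^ k * x.2),
    min r₁ r₂, lt_min hr₁ hr₂, C, hC, ?_⟩
  intro z w hz hw
  have hz1 := lt_of_lt_of_le hz (min_le_left _ _)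
  have hz2 := lt_of_lt_of_le hz (min_le_right _ _)
  have hw1 := lt_of_lt_of_le hw (min_le_left _ _)
  have hw2 := lt_of_lt_of_le hw (min_le_right _ _)
  have hU' : ∀ k : ℕ, (z, ζ ^ k * w) ∈ U := fun k => hmem _ _ hz2 (by rw [hnk]; exact hw2)
  have hcd : ∀ k : ℕ, ContDiffAt ℝ 2 (fun x : (Fin d → ℂ) × ℂ => φ (x.1, ζ ^ k * x.2)) (z, w) := by
    intro k
    exact ContDiffAt.comp (f := fun x : (Fin d → ℂ) × ℂ => (x.1, ζ ^ k * x.2)) (z, w)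
      (hφ _ (hU' k)) (by fun_prop)
  refine ⟨contDiffAt_const.mul (ContDiffAt.sum fun k _ => hcd k), ?_, ?_⟩
  · intro v
    rw [lineLap_const_mul, lineLap_sum hcd]
    refine mul_nonneg (by positivity) (Finset.sum_nonneg fun k _ => ?_)
    have h1 : lineLap (fun x : (Fin d → ℂ) × ℂ => φ (x.1, ζ ^ k * x.2)) (z, w) v =
        lineLap φ (z, ζ ^ k * w) (v.1, ζ ^ k * v.2) := by
      unfold lineLap lineD2
      congr 2
      · funext t
        beta_reduce
        congr 1
        ext <;> simp
        ring
      · funext t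
        beta_reduce
        congr 1
        ext <;> simp
        ring
    rw [h1]
    have h2 := hpsh _ (hU' k) (v.1, ζ ^ k * v.2)
    rw [cHess_re_eq (hφ _ (hU' k))] at h2
    linarith
  · have hs := root_sum m ζ hζ (fun p => φc p z) w
    have hNc : (2 * m + 1 : ℂ) ≠ 0 := by exact_mod_cast hNpos.ne'
    have e : (((2 * m + 1 : ℝ)⁻¹ * ∑ k ∈ Finset.range (2 * m + 1), φ (z, ζ ^ k * w) : ℝ) : ℂ) -
        φc m z * (‖w‖ : ℂ) ^ (2 * m) = (2 * m + 1 : ℂ)⁻¹ * ∑ k ∈ Finset.range (2 * m + 1),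
          ((φ (z, ζ ^ k * w) : ℂ) - ∑ p ∈ Finset.range (2 * m + 1),
            φc p z * (ζ ^ k * w) ^ p * (starRingEnd ℂ (ζ ^ k * w)) ^ (2 * m - p)) := by
      rw [Finset.sum_sub_distrib, hs, mul_sub, inv_mul_cancel_left₀ hNc]
      push_cast
      rfl
    simp only at e ⊢
    rw [e, norm_mul, norm_inv]
    have h3 : ‖(2 * m + 1 : ℂ)‖ = 2 * m + 1 := by
      have : (2 * m + 1 : ℂ) = ((2 * m + 1 : ℝ) : ℂ) := by push_cast; rfl
      rw [this, Complex.norm_real, Real.norm_of_nonneg hNpos.le]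
    rw [h3, inv_mul_le_iff₀ hNpos]
    refine (norm_sum_le_of_le _ fun k _ =>
      (hb z (ζ ^ k * w) hz1 (by rw [hnk]; exact hw1) (hU' k))).trans ?_
    simp only [hnk]
    simp

/-- If `φ(z,w) = ∑_{p+q=n} φ^{(p,q)}(z) w^p conj(w)^q + O(|w|^{n+1})` is smooth and
plurisubharmonic, with `n = 2m` even, then `φ^{(m,m)}` is a non-negative real-valued
plurisubharmonic function of `z` on the slice `{w = 0}`. -/
theorem stmt11 {d : ℕ} (U : Set ((Fin d → ℂ) × ℂ)) (hU : IsOpen U)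
    (n m : ℕ) (hm : 0 < m) (hnm : n = 2 * m)
    (φ : (Fin d → ℂ) × ℂ → ℝ) (hsm : ContDiffOn ℝ (⊤ : ℕ∞) φ U) (hpsh : PSHOn φ U)
    (φc : ℕ → (Fin d → ℂ) → ℂ) (hφc : ∀ p, ContDiff ℝ (⊤ : ℕ∞) (φc p))
    (hexp : ∀ z₀ : Fin d → ℂ, (z₀, (0 : ℂ)) ∈ U →
      ∃ C > (0 : ℝ), ∃ r > (0 : ℝ), ∀ (z : Fin d → ℂ) (w : ℂ),
        ‖z - z₀‖ < r → ‖w‖ < r → (z, w) ∈ U →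
        ‖(φ (z, w) : ℂ) - ∑ p ∈ Finset.range (n + 1),
            φc p z * w ^ p * (starRingEnd ℂ w) ^ (n - p)‖ ≤ C * ‖w‖ ^ (n + 1)) :
    (∀ z : Fin d → ℂ, (z, (0 : ℂ)) ∈ U → (φc m z).im = 0 ∧ 0 ≤ (φc m z).re) ∧
    PSHOn (fun z => (φc m z).re) {z : Fin d → ℂ | (z, (0 : ℂ)) ∈ U} := by

  subst hnm
  have hav := fun z₀ hz₀ => avg_exists U hU m φ hsm hpsh φc z₀ hz₀ (hexp z₀ hz₀)
  refine ⟨?_, ?_⟩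
  · intro z hz
    obtain ⟨A, r, hr, C, hC, hA⟩ := hav z hz
    have hA' := fun w hw => hA z w (by simpa using hr) hw
    have hsmall : ∀ a : ℝ, (∀ ρ : ℝ, 0 < ρ → ρ < r → a ≤ C * ρ) → a ≤ 0 := by
      intro a ha
      by_contra! hpos
      have h1 := ha (min (r / 2) (a / (2 * C))) (by positivity)
        (lt_of_le_of_lt (min_le_left _ _) (by linarith))
      have h2 : C * min (r / 2) (a / (2 * C)) ≤ C * (a / (2 * C)) := by
        gcongr
        exact min_le_right _ _
      have h3 : C * (a / (2 * C)) = a / 2 := by field_simp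
      linarith
    constructor
    · have : |(φc m z).im| ≤ 0 := by
        refine hsmall _ fun ρ hρ hρr => ?_
        have hn : ‖(ρ : ℂ)‖ = ρ := by simp [abs_of_pos hρ]
        have h := (hA' (ρ : ℂ) (by rw [hn]; exact hρr)).2.2
        have h2 := (Complex.abs_im_le_norm _).trans h
        rw [hn] at h2
        have h4 : ((A (z, (ρ : ℂ)) : ℂ) - φc m z * (ρ : ℂ) ^ (2 * m)).im =
            - ((φc m z).im * ρ ^ (2 * m)) := by
          rw [← Complex.ofReal_pow, Complex.sub_im, Complex.im_mul_ofReal, Complex.ofReal_im]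
          ring
        rw [h4, abs_neg, abs_mul, abs_of_pos (pow_pos hρ _), pow_succ] at h2
        have h5 := pow_pos hρ (2 * m)
        refine le_of_mul_le_mul_right ?_ h5
        linarith
      simpa using this
    · have : -(φc m z).re ≤ 0 := by
        refine hsmall _ fun ρ hρ hρr => ?_
        have hA0 : A (z, 0) = 0 := by
          have h := (hA' 0 (by simpa using hr)).2.2
          have hm2 : 2 * m ≠ 0 := by omega
          simpa [hm2] using h
        have hsph : ∀ l : ℂ, ‖l‖ = ρ → A ((z, 0) + l • ((0 : Fin d → ℂ), (1 : ℂ))) ≤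
            (φc m z).re * ρ ^ (2 * m) + C * ρ ^ (2 * m + 1) := by
          intro l hl
          have e : (z, 0) + l • ((0 : Fin d → ℂ), (1 : ℂ)) = (z, l) := by ext <;> simp
          rw [e]
          have h := (hA' l (by rw [hl]; exact hρr)).2.2
          have h2 := (le_abs_self _).trans ((Complex.abs_re_le_norm _).trans h)
          rw [hl] at h2
          have h4 : ((A (z, l) : ℂ) - φc m z * (ρ : ℂ) ^ (2 * m)).re =
            A (z, l) - ((φc m z).re * ρ ^ (2 * m)) := by
            rw [← Complex.ofReal_pow, Complex.sub_re, Complex.re_mul_ofReal, Complex.ofReal_re]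
          rw [h4] at h2
          linarith
        have hmax : ∀ κ : ℝ, 0 < κ →
            A (z, 0) ≤ (φc m z).re * ρ ^ (2 * m) + C * ρ ^ (2 * m + 1) + κ * ρ ^ 2 := by
          intro κ hκ
          have e : ∀ l : ℂ, (z, 0) + l • ((0 : Fin d → ℂ), (1 : ℂ)) = (z, l) := by
            intro l
            ext <;> simp
          refine max_principle A (z, 0) ((0 : Fin d → ℂ), (1 : ℂ)) ρ κ _ hρ ?_ ?_ hsph
          · intro l hl
            rw [e]
            exact (hA' l (lt_of_le_of_lt hl hρr)).1
          · intro l hl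
            rw [e]
            have := (hA' l (hl.trans hρr)).2.1 ((0 : Fin d → ℂ), (1 : ℂ))
            linarith
        rw [hA0] at hmax
        have h6 : 0 ≤ (φc m z).re * ρ ^ (2 * m) + C * ρ ^ (2 * m + 1) := by
          refine le_of_forall_pos_le_add fun ε hε => ?_
          have := hmax (ε / ρ ^ 2) (by positivity)
          rwa [div_mul_cancel₀ _ (by positivity)] at this
        have h5 := pow_pos hρ (2 * m)
        rw [pow_succ] at h6
        refine le_of_mul_le_mul_right ?_ h5
        linarith
      linarith
  · intro z₀ hz₀ v
    have hz₀' : (z₀, (0 : ℂ)) ∈ U := hz₀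
    obtain ⟨A, r, hr, C, hC, hA⟩ := hav z₀ hz₀'
    have hψ : ContDiff ℝ 2 (fun z => (φc m z).re) :=
      (Complex.reCLM.contDiff.comp (hφc m)).of_le (WithTop.coe_le_coe.mpr (le_top : (2 : ℕ∞) ≤ ⊤))
    rw [cHess_re_eq hψ.contDiffAt]
    by_contra! hneg
    have hneg' : lineLap (fun z => (φc m z).re) z₀ v < 0 := by linarith
    have hcont : Continuous fun z => lineLap (fun z => (φc m z).re) z v := by
      have e : ∀ z u, lineD2 (fun z => (φc m z).re) z u = _ :=
        fun z u => lineD2_eq hψ.contDiffAt u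
      simp only [lineLap, e]
      have h1 : ∀ u, ContDiff ℝ 1 (fun y => fderiv ℝ (fun z => (φc m z).re) y u) := fun u =>
        (hψ.fderiv_right (m := 1) (by norm_num)).clm_apply contDiff_const
      have h2 : ∀ u, Continuous fun x =>
          fderiv ℝ (fun y => fderiv ℝ (fun z => (φc m z).re) y u) x u := fun u =>
        ((h1 u).continuous_fderiv (by simp)).clm_apply continuous_const
      exact (h2 v).add (h2 _)
    obtain ⟨δ, hδ, hδ2⟩ : ∃ δ > 0, lineLap (fun z => (φc m z).re) z₀ v < -(4 * δ) :=
      ⟨-(lineLap (fun z => (φc m z).re) z₀ v) / 8, by linarith, by linarith⟩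
    have hline : Filter.Tendsto (fun l : ℂ => z₀ + l • v) (nhds 0) (nhds z₀) := by
      have : ContinuousAt (fun l : ℂ => z₀ + l • v) 0 := by fun_prop
      simpa using this.tendsto
    have hev1 : ∀ᶠ l : ℂ in nhds 0,
        lineLap (fun z => (φc m z).re) (z₀ + l • v) v < -(4 * δ) :=
      hline.eventually (hcont.continuousAt.eventually_lt_const hδ2)
    have hev2 : ∀ᶠ l : ℂ in nhds 0, ‖z₀ + l • v - z₀‖ < r := by
      have := hline.eventually (Metric.ball_mem_nhds z₀ hr)
      filter_upwards [this] with l hl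
      simpa [dist_eq_norm] using hl
    obtain ⟨s', hs', hs⟩ := Metric.eventually_nhds_iff.mp (hev1.and hev2)
    set s := s' / 2 with hsdef
    have hs0 : 0 < s := by positivity
    have hs2 : ∀ l : ℂ, ‖l‖ ≤ s → lineLap (fun z => (φc m z).re) (z₀ + l • v) v < -(4 * δ) ∧
        ‖z₀ + l • v - z₀‖ < r := by
      intro l hl
      apply hs
      rw [dist_zero_right]
      linarith
    have key : ∀ ρ : ℝ, 0 < ρ → ρ < r → δ * s ^ 2 ≤ 2 * C * ρ := by
      intro ρ hρ hρr
      have hn : ‖(ρ : ℂ)‖ = ρ := by simp [abs_of_pos hρ]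
      have hρm := pow_pos hρ (2 * m)
      let F : (Fin d → ℂ) × ℂ → ℝ := fun x => (ρ ^ (2 * m))⁻¹ * A x - (φc m x.1).re
      have hest : ∀ z, ‖z - z₀‖ < r → |F (z, (ρ : ℂ))| ≤ C * ρ := by
        intro z hz
        have h := (hA z (ρ : ℂ) hz (by rw [hn]; exact hρr)).2.2
        have h2 := (Complex.abs_re_le_norm _).trans h
        rw [hn] at h2
        have h4 : ((A (z, (ρ : ℂ)) : ℂ) - φc m z * (ρ : ℂ) ^ (2 * m)).re =
            ρ ^ (2 * m) * F (z, (ρ : ℂ)) := by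
          rw [← Complex.ofReal_pow, Complex.sub_re, Complex.re_mul_ofReal, Complex.ofReal_re]
          simp only [F]
          field_simp
        rw [h4, abs_mul, abs_of_pos hρm, pow_succ] at h2
        refine le_of_mul_le_mul_left ?_ hρm
        linarith
      have e : ∀ l : ℂ, (z₀, (ρ : ℂ)) + l • (v, (0 : ℂ)) = (z₀ + l • v, (ρ : ℂ)) := by
        intro l
        ext <;> simp
      have hψ2 : ContDiff ℝ 2 (fun x : (Fin d → ℂ) × ℂ => (φc m x.1).re) :=
        hψ.comp contDiff_fst
      have hAz : ∀ l : ℂ, ‖l‖ ≤ s → _ := fun l hl =>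
        hA (z₀ + l • v) (ρ : ℂ) (hs2 l hl).2 (by rw [hn]; exact hρr)
      have hmax := max_principle F (z₀, (ρ : ℂ)) (v, (0 : ℂ)) s (-δ) (C * ρ) hs0 ?_ ?_ ?_
      · have := hest z₀ (by simpa using hr)
        have := neg_abs_le (F (z₀, (ρ : ℂ)))
        linarith
      · intro l hl
        rw [e]
        exact (contDiffAt_const.mul (hAz l hl).1).sub hψ2.contDiffAt
      · intro l hl
        rw [e]
        simp only [F]
        rw [lineLap_sub (contDiffAt_const.mul (hAz l hl.le).1) hψ2.contDiffAt,
          lineLap_const_mul]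
        have h1 : lineLap (fun x : (Fin d → ℂ) × ℂ => (φc m x.1).re)
            (z₀ + l • v, (ρ : ℂ)) (v, 0) = lineLap (fun z => (φc m z).re) (z₀ + l • v) v := rfl
        rw [h1]
        have h2 := (hs2 l hl.le).1
        have h3 : 0 ≤ (ρ ^ (2 * m))⁻¹ * lineLap A (z₀ + l • v, (ρ : ℂ)) (v, 0) :=
          mul_nonneg (by positivity) ((hAz l hl.le).2.1 _)
        linarith
      · intro l hl
        rw [e]
        exact (le_abs_self _).trans (hest _ (hs2 l hl.le).2)
    have hpos : 0 < δ * s ^ 2 := by positivity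
    have h1 := key (min (r / 2) (δ * s ^ 2 / (4 * C))) (by positivity)
      (lt_of_le_of_lt (min_le_left _ _) (by linarith))
    have h2 : 2 * C * min (r / 2) (δ * s ^ 2 / (4 * C)) ≤ 2 * C * (δ * s ^ 2 / (4 * C)) := by
      gcongr
      exact min_le_right _ _
    have h3 : 2 * C * (δ * s ^ 2 / (4 * C)) = δ * s ^ 2 / 2 := by field_simp; ring
    linarith
end

section
/- Let U ⊆ ℂ^d × ℂ be open with coordinates (z, w) containing U₀ × {0}, fix an even integer n = 2m ≥ 2, and let φ : U → ℝ be a smooth plurisubharmonic function of the form φ(z, w) = Σ_{p+q = n} φ^{(p,q)}(z)·w^p conj(w)^q + O(|w|^{n+1}) with smooth coefficients. If φ^{(m,m)} is constant on U₀, then for every z ∈ U₀ and every ξ ∈ ℂ^d and every pair (p,q) with p + q = n, one has Σ_{ν,μ} ξ_ν conj(ξ_μ) ∂²φ^{(p,q)}/∂z_ν∂conj(z_μ)(z) = 0 when (p,q) = (m,m); moreover the same vanishing then holds for all (p,q) with p, q ≥ 0, p + q = n. -/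
open Complex

open Filter Topology Asymptotics in
lemma aux_taylor {E F : Type*} [NormedAddCommGroup E] [NormedSpace ℝ E]
    [NormedAddCommGroup F] [NormedSpace ℝ F] {f : E → F} {x : E} (hf : ContDiffAt ℝ 2 f x) :
    (fun v : E => f (x + v) - f x - fderiv ℝ f x v
      - (1 / 2 : ℝ) • fderiv ℝ (fderiv ℝ f) x v v) =o[𝓝 0] fun v => ‖v‖ ^ 2 := by
  set D := fderiv ℝ f x
  set B := fderiv ℝ (fderiv ℝ f) x with hB
  have hsymm : ∀ v w, B v w = B w v := fun v w =>
    (hf.isSymmSndFDerivAt (by simp)) v w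
  have hd1 : ∀ᶠ y in 𝓝 x, DifferentiableAt ℝ f y := by
    filter_upwards [hf.eventually (by simp)] with y hy
    exact hy.differentiableAt (by norm_num)
  have hd2 : HasFDerivAt (fderiv ℝ f) B x :=
    ((hf.fderiv_right (m := 1) (by norm_num)).differentiableAt (by norm_num)).hasFDerivAt
  have hlim : Tendsto (fun v : E => x + v) (𝓝 0) (𝓝 x) := by
    have : Continuous (fun v : E => x + v) := by fun_prop
    simpa using this.tendsto 0
  obtain ⟨r, hr, hball⟩ := Metric.eventually_nhds_iff_ball.1 (hlim.eventually hd1)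
  let r' : E → E →L[ℝ] F := fun v => fderiv ℝ f (x + v) - D - B v
  have hder : ∀ v ∈ Metric.ball (0 : E) r,
      HasFDerivWithinAt (fun v : E => f (x + v) - f x - D v - (1 / 2 : ℝ) • B v v) (r' v)
        (Metric.ball 0 r) v := by
    intro v hv
    apply HasFDerivAt.hasFDerivWithinAt
    have h1 : HasFDerivAt (fun v : E => f (x + v)) (fderiv ℝ f (x + v)) v := by
      have := (hball v hv).hasFDerivAt.comp v ((hasFDerivAt_id v).const_add x)
      simpa [Function.comp_def] using this
    have h2 : HasFDerivAt (fun v : E => B v v) _ v :=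
      (B.hasFDerivAt (x := v)).clm_apply (hasFDerivAt_id v)
    have h3 := ((h1.sub_const (f x)).sub (D.hasFDerivAt (x := v))).sub (h2.const_smul (1 / 2 : ℝ))
    refine h3.congr_fderiv ?_
    ext w
    simp only [r', sub_apply, smul_apply,
      add_apply, ContinuousLinearMap.comp_apply,
      ContinuousLinearMap.flip_apply, ContinuousLinearMap.id_apply]
    rw [hsymm w v, ← two_smul ℝ (B v w), smul_smul]
    norm_num
  have ho : r' =o[𝓝[Metric.ball 0 r] 0] fun v => ‖v - 0‖ ^ 1 := by
    refine IsLittleO.mono ?_ nhdsWithin_le_nhds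
    have := (hasFDerivAt_iff_isLittleO_nhds_zero.1 hd2)
    simpa [r'] using this.norm_right
  have := (convex_ball (0 : E) r).isLittleO_pow_succ (Metric.mem_ball_self hr) hder ho
  rw [nhdsWithin_eq_nhds.2 (Metric.ball_mem_nhds _ hr)] at this
  simpa using this

open Filter Topology Asymptotics in
lemma aux_max (g : ℂ → ℝ) (α β a b c : ℝ)
    (hg : (fun t : ℂ => g t - g 0 - (α * t.re + β * t.im
      + (a * t.re ^ 2 + 2 * b * t.re * t.im + c * t.im ^ 2) / 2)) =o[𝓝 0] fun t => ‖t‖ ^ 2)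
    (ρ₀ : ℝ) (hρ₀ : 0 < ρ₀)
    (h : ∀ δ > 0, ∃ u : ℂ → ℝ, ContinuousOn u (Metric.closedBall 0 ρ₀) ∧
      (∀ t ∈ Metric.ball (0 : ℂ) ρ₀, ∃ l ≥ (0 : ℝ), Tendsto (fun s : ℝ =>
        (u (t + s) + u (t - s) + u (t + s * I) + u (t - s * I) - 4 * u t) / s ^ 2)
        (𝓝[>] 0) (𝓝 l)) ∧ ∀ t ∈ Metric.closedBall (0 : ℂ) ρ₀, |u t - g t| ≤ δ) :
    0 ≤ a + c := by
  by_contra hneg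
  push Not at hneg
  obtain ⟨ε, hε⟩ : ∃ ε, ε = -(a + c) / 16 := ⟨_, rfl⟩
  have hε0 : 0 < ε := by linarith
  have h1 := hg.def (c := 2 * ε) (by linarith)
  obtain ⟨ρ₁, hρ₁, hb⟩ := Metric.eventually_nhds_iff_ball.1 h1
  set ρ := min (ρ₁ / 2) ρ₀ with hρdef
  have hρ : 0 < ρ := lt_min (by linarith) hρ₀
  have hρle : ρ ≤ ρ₀ := min_le_right _ _
  have hρlt : ρ < ρ₁ := lt_of_le_of_lt (min_le_left _ _) (by linarith)
  obtain ⟨u, huc, hul, hug⟩ := h (ε * ρ ^ 2 / 4) (by positivity)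
  let H : ℂ → ℝ := fun t => α * t.re + β * t.im + (a - c) / 4 * (t.re ^ 2 - t.im ^ 2)
    + b * t.re * t.im - ε * (t.re ^ 2 + t.im ^ 2)
  have hHc : Continuous H := by fun_prop
  have hsub : Metric.closedBall (0 : ℂ) ρ ⊆ Metric.closedBall 0 ρ₀ :=
    Metric.closedBall_subset_closedBall hρle
  obtain ⟨t, ht, hmax⟩ := (isCompact_closedBall (0 : ℂ) ρ).exists_isMaxOn
    ⟨0, Metric.mem_closedBall_self hρ.le⟩ ((huc.mono hsub).sub hHc.continuousOn)
  have htlt : t ∈ Metric.ball (0 : ℂ) ρ := by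
    by_contra hcon
    have hn : ‖t‖ = ρ := by
      simp at ht hcon
      exact le_antisymm ht hcon
    have hm0 : u 0 - H 0 ≤ u t - H t := hmax (Metric.mem_closedBall_self hρ.le)
    have e1 := hug t (hsub ht)
    have e2 := hug 0 (Metric.mem_closedBall_self hρ₀.le)
    have e3 := hb t (by simp [hn, hρlt])
    have hsq : t.re ^ 2 + t.im ^ 2 = ρ ^ 2 := by
      rw [← hn, Complex.sq_norm, Complex.normSq_apply]; ring
    rw [Real.norm_eq_abs, Real.norm_eq_abs, abs_of_nonneg (by positivity : 0 ≤ ‖t‖ ^ 2), hn] at e3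
    have e1' := (abs_le.1 e1).2
    have e2' := (abs_le.1 e2).1
    have e3' := (abs_le.1 e3).2
    have hH0 : H 0 = 0 := by simp [H]
    have hHt : H t = α * t.re + β * t.im
      + (a * t.re ^ 2 + 2 * b * t.re * t.im + c * t.im ^ 2) / 2 + 3 * ε * ρ ^ 2 := by
      rw [← hsq, hε]; simp only [H, hε]; ring
    rw [hH0, hHt] at hm0
    have : 0 < ε * ρ ^ 2 := by positivity
    linarith
  obtain ⟨l, hl, hlim⟩ := hul t (Metric.ball_subset_ball hρle htlt)
  have hnb : ∀ᶠ y in 𝓝 t, u y - H y ≤ u t - H t := by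
    filter_upwards [Metric.isOpen_ball.mem_nhds htlt] with y hy
    exact hmax (Metric.ball_subset_closedBall hy)
  have hcv : ∀ v : ℂ, ∀ᶠ s : ℝ in 𝓝[>] 0, u (t + s * v) - H (t + s * v) ≤ u t - H t := by
    intro v
    have hc : Continuous (fun s : ℝ => t + s * v) := by fun_prop
    have : Tendsto (fun s : ℝ => t + s * v) (𝓝[>] 0) (𝓝 t) := by
      have := hc.tendsto 0
      simp only [ofReal_zero, zero_mul, add_zero] at this
      exact this.mono_left nhdsWithin_le_nhds
    exact this.eventually hnb
  have hle : l ≤ -4 * ε := by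
    refine le_of_tendsto hlim ?_
    filter_upwards [hcv 1, hcv (-1), hcv I, hcv (-I), self_mem_nhdsWithin] with s h1 h2 h3 h4 hs
    have hs' : (0 : ℝ) < s := hs
    rw [div_le_iff₀ (by positivity)]
    simp only [mul_neg, mul_one, ← sub_eq_add_neg] at h1 h2 h3 h4
    simp only [H, add_re, add_im, sub_re, sub_im, mul_re, mul_im, ofReal_re, ofReal_im, I_re, I_im]
      at h1 h2 h3 h4
    ring_nf at h1 h2 h3 h4 ⊢
    linarith
  linarith

open Filter Topology Asymptotics in
lemma aux_cHess {E : Type*} [NormedAddCommGroup E] [NormedSpace ℂ E] {f : E → ℂ} {z : E}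
    (hf : ContDiffAt ℝ 2 f z) (v : E) :
    cHess f z v v = (fderiv ℝ (fderiv ℝ f) z v v
      + fderiv ℝ (fderiv ℝ f) z (I • v) (I • v)) / 4 := by
  have hsymm : ∀ v w, fderiv ℝ (fderiv ℝ f) z v w = fderiv ℝ (fderiv ℝ f) z w v :=
    fun v w => (hf.isSymmSndFDerivAt (by simp)) v w
  have hd2 : HasFDerivAt (fderiv ℝ f) (fderiv ℝ (fderiv ℝ f) z) z :=
    ((hf.fderiv_right (m := 1) (by norm_num)).differentiableAt (by norm_num)).hasFDerivAt
  have h1 : ∀ w : E, HasFDerivAt (fun x => fderiv ℝ f x w)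
      ((fderiv ℝ (fderiv ℝ f) z).flip w) z := by
    intro w
    refine (hd2.clm_apply (hasFDerivAt_const w z)).congr_fderiv ?_
    ext y; simp
  have h2 : HasFDerivAt (fun x => wBarDeriv f x v) ((2⁻¹ : ℂ) •
      ((fderiv ℝ (fderiv ℝ f) z).flip v + I • (fderiv ℝ (fderiv ℝ f) z).flip (I • v))) z := by
    have := ((h1 v).add ((h1 (I • v)).const_smul I)).const_smul (2⁻¹ : ℂ)
    refine this.congr_of_eventuallyEq (Eventually.of_forall fun x => ?_)
    simp [wBarDeriv]; ring
  unfold cHess wDeriv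
  rw [h2.fderiv]
  simp only [smul_apply, add_apply, ContinuousLinearMap.flip_apply, smul_eq_mul]
  rw [hsymm (I • v) v]
  linear_combination (-(1/4) * fderiv ℝ (fderiv ℝ f) z (I • v) (I • v)) * I_sq

open Filter Topology Asymptotics in
lemma aux_two {E : Type*} [NormedAddCommGroup E] [NormedSpace ℝ E] {f : E → ℂ} {z : E}
    (hf : ContDiffAt ℝ 2 f z) (v : E) :
    Tendsto (fun s : ℝ => (f (z + s • v) + f (z - s • v) - 2 * f z) / (s : ℂ) ^ 2) (𝓝[>] 0)
      (𝓝 (fderiv ℝ (fderiv ℝ f) z v v)) := by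
  have hT : ∀ w : E, Tendsto (fun s : ℝ => (f (z + s • w) - f z - fderiv ℝ f z (s • w)
      - (1 / 2 : ℝ) • fderiv ℝ (fderiv ℝ f) z (s • w) (s • w)) / (s : ℂ) ^ 2) (𝓝[>] 0) (𝓝 0) := by
    intro w
    have hl : Tendsto (fun s : ℝ => s • w) (𝓝[>] 0) (𝓝 0) := by
      have hc : Continuous (fun s : ℝ => s • w) := by fun_prop
      have := hc.tendsto 0
      simp only [zero_smul] at this
      exact this.mono_left nhdsWithin_le_nhds
    have h1 := (aux_taylor hf).comp_tendsto hl
    have h2 : ((fun v : E => ‖v‖ ^ 2) ∘ fun s : ℝ => s • w) =O[𝓝[>] 0]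
        fun s : ℝ => (s : ℂ) ^ 2 := by
      refine IsBigO.of_bound (‖w‖ ^ 2) (Eventually.of_forall fun s => ?_)
      simp [norm_smul, mul_pow, mul_comm]
    exact (h1.trans_isBigO h2).tendsto_div_nhds_zero
  have h := ((hT v).add (hT (-v))).add_const (fderiv ℝ (fderiv ℝ f) z v v)
  rw [add_zero, zero_add] at h
  refine h.congr' ?_
  filter_upwards [self_mem_nhdsWithin] with s hs
  have hs' : (s : ℂ) ≠ 0 := by exact_mod_cast (ne_of_gt hs)
  simp only [map_smul, smul_apply, map_neg, smul_neg, neg_apply, neg_neg, Complex.real_smul,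
    ← sub_eq_add_neg]
  push_cast
  field_simp
  ring

open Filter Topology Asymptotics in
lemma aux_four {E : Type*} [NormedAddCommGroup E] [NormedSpace ℂ E] {f : E → ℂ} {z : E}
    (hf : ContDiffAt ℝ 2 f z) (v : E) :
    Tendsto (fun s : ℝ => (f (z + s • v) + f (z - s • v) + f (z + s • (I • v))
      + f (z - s • (I • v)) - 4 * f z) / (s : ℂ) ^ 2) (𝓝[>] 0) (𝓝 (4 * cHess f z v v)) := by
  rw [aux_cHess hf]
  have := (aux_two hf v).add (aux_two hf (I • v))
  convert this using 2
  · ring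
  · ring

open Filter Topology Asymptotics in
lemma aux_pos {E : Type*} [NormedAddCommGroup E] [NormedSpace ℂ E] {f : E → ℂ} {z : E}
    (hf : ContDiffAt ℝ 2 f z) (ξ : E) (κ : ℂ →L[ℝ] ℝ) (ρ₀ : ℝ) (hρ₀ : 0 < ρ₀)
    (h : ∀ δ > 0, ∃ u : ℂ → ℝ, ContinuousOn u (Metric.closedBall 0 ρ₀) ∧
      (∀ t ∈ Metric.ball (0 : ℂ) ρ₀, ∃ l ≥ (0 : ℝ), Tendsto (fun s : ℝ =>
        (u (t + s) + u (t - s) + u (t + s * I) + u (t - s * I) - 4 * u t) / s ^ 2)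
        (𝓝[>] 0) (𝓝 l)) ∧ ∀ t ∈ Metric.closedBall (0 : ℂ) ρ₀, |u t - κ (f (z + t • ξ))| ≤ δ) :
    0 ≤ κ (cHess f z ξ ξ) := by
  set B := fderiv ℝ (fderiv ℝ f) z with hB
  have hsymm : ∀ v w, B v w = B w v :=
    fun v w => (hf.isSymmSndFDerivAt (by simp)) v w
  have key := aux_max (fun t => κ (f (z + t • ξ))) (κ (fderiv ℝ f z ξ)) (κ (fderiv ℝ f z (I • ξ)))
    (κ (B ξ ξ)) (κ (B ξ (I • ξ))) (κ (B (I • ξ) (I • ξ))) ?_ ρ₀ hρ₀ h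
  · rw [aux_cHess hf]
    have : (B ξ ξ + B (I • ξ) (I • ξ)) / 4 = (1 / 4 : ℝ) • (B ξ ξ + B (I • ξ) (I • ξ)) := by
      rw [Complex.real_smul]; push_cast; ring
    rw [this, map_smul, map_add, smul_eq_mul]
    linarith
  · have hl : Tendsto (fun t : ℂ => t • ξ) (𝓝 0) (𝓝 0) := by
      have hc : Continuous (fun t : ℂ => t • ξ) := by fun_prop
      simpa using hc.tendsto 0
    have h1 := (aux_taylor hf).comp_tendsto hl
    have h2 : ((fun v : E => ‖v‖ ^ 2) ∘ fun t : ℂ => t • ξ) =O[𝓝 0]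
        fun t : ℂ => ‖t‖ ^ 2 := by
      refine IsBigO.of_bound (‖ξ‖ ^ 2) (Eventually.of_forall fun s => ?_)
      simp [norm_smul, mul_pow, mul_comm]
    have h3 := (κ.isBigO_comp _ _).trans_isLittleO (h1.trans_isBigO h2)
    refine h3.congr_left fun t => ?_
    have ht : t • ξ = t.re • ξ + t.im • (I • ξ) := by
      conv_lhs => rw [← re_add_im t, add_smul, mul_smul]
      simp
    simp only [Function.comp, zero_smul, add_zero, map_sub, map_smul, ← hB]
    have e1 : fderiv ℝ f z (t • ξ)
        = t.re • fderiv ℝ f z ξ + t.im • fderiv ℝ f z (I • ξ) := by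
      rw [ht, map_add, map_smul, map_smul]
    have e2 : B (t • ξ) (t • ξ) = (t.re ^ 2) • B ξ ξ + (2 * t.re * t.im) • B ξ (I • ξ)
        + (t.im ^ 2) • B (I • ξ) (I • ξ) := by
      rw [ht]
      simp only [map_add, map_smul, add_apply, smul_apply]
      rw [hsymm (I • ξ) ξ]
      module
    rw [e1, e2]
    simp only [map_add, map_smul, smul_eq_mul]
    ring

lemma aux_trig (n m : ℕ) (hnm : n = 2 * m) (c : ℕ → ℂ) (hc : c m = 0)
    (hre : ∀ ω : ℂ, ‖ω‖ = 1 →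
      0 ≤ (∑ p ∈ Finset.range (n + 1), c p * (ω ^ p * (starRingEnd ℂ ω) ^ (n - p))).re)
    (him : ∀ ω : ℂ, ‖ω‖ = 1 →
      (∑ p ∈ Finset.range (n + 1), c p * (ω ^ p * (starRingEnd ℂ ω) ^ (n - p))).im = 0) :
    ∀ p ≤ n, c p = 0 := by
  set P : ℂ → ℂ := fun ω => ∑ p ∈ Finset.range (n + 1), c p * (ω ^ p * (starRingEnd ℂ ω) ^ (n - p))
    with hP
  have hζ := Complex.isPrimitiveRoot_exp (n + 1) (by omega)
  set ζ := Complex.exp (2 * Real.pi * I / (n + 1 : ℕ)) with hζd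
  obtain ⟨η, hη⟩ : ∃ η : ℂ, η ^ 2 = ζ := IsAlgClosed.exists_pow_nat_eq ζ (by norm_num)
  have hζ1 : ‖ζ‖ = 1 := hζ.norm'_eq_one (by omega)
  have hη1 : ‖η‖ = 1 := by
    have : ‖η‖ ^ 2 = 1 := by rw [← norm_pow, hη, hζ1]
    nlinarith [norm_nonneg η]
  have hconj : ∀ x : ℂ, ‖x‖ = 1 → x * starRingEnd ℂ x = 1 := by
    intro x hx; rw [Complex.mul_conj, Complex.normSq_eq_norm_sq, hx]; simp
  have hqz : ∀ x : ℂ, ‖x‖ = 1 → ∀ p ≤ n, (x ^ p * (starRingEnd ℂ x) ^ (n - p)) * x ^ n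
      = (x ^ 2) ^ p := by
    intro x hx p hp
    obtain ⟨k, rfl⟩ := Nat.exists_eq_add_of_le hp
    have : (x * starRingEnd ℂ x) ^ k = 1 := by rw [hconj x hx, one_pow]
    rw [mul_pow] at this
    rw [Nat.add_sub_cancel_left, pow_add]
    linear_combination (x ^ p * x ^ p) * this
  have hη0 : η ≠ 0 := by intro h; simp [h] at hη1
  have hsum : ∀ p ≤ n, p ≠ m →
      ∑ j ∈ Finset.range (n + 1), (η ^ p * (starRingEnd ℂ η) ^ (n - p)) ^ j = 0 := by
    intro p hp hpm
    set q := η ^ p * (starRingEnd ℂ η) ^ (n - p) with hq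
    have hq1 : q * ζ ^ m = ζ ^ p := by
      rw [← hη, ← hqz η hη1 p hp, ← pow_mul, ← hnm]
    have hζm : ζ ^ m ≠ 0 := by rw [← hη]; positivity
    have hqN : q ^ (n + 1) = 1 := by
      have := congrArg (· ^ (n + 1)) hq1
      simp only [mul_pow, ← pow_mul] at this
      rw [mul_comm m, mul_comm p, pow_mul, pow_mul, hζ.pow_eq_one] at this
      simpa using this
    have hqne : q ≠ 1 := by
      intro h
      rw [h, one_mul] at hq1
      exact hpm (hζ.pow_inj (by omega) (by omega) hq1).symm
    rw [geom_sum_eq hqne, hqN]; simp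
  have hre0 : ∀ ω : ℂ, ‖ω‖ = 1 → (P ω).re = 0 := by
    intro ω hω
    have hs : ∑ j ∈ Finset.range (n + 1), P (ω * η ^ j) = 0 := by
      simp only [hP]
      rw [Finset.sum_comm]
      refine Finset.sum_eq_zero fun p hp => ?_
      have hp' : p ≤ n := by simpa [Nat.lt_succ_iff] using hp
      by_cases hpm : p = m
      · simp [hpm, hc]
      · have : ∀ j, c p * ((ω * η ^ j) ^ p * (starRingEnd ℂ (ω * η ^ j)) ^ (n - p))
            = c p * (ω ^ p * (starRingEnd ℂ ω) ^ (n - p))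
              * (η ^ p * (starRingEnd ℂ η) ^ (n - p)) ^ j := by
          intro j
          simp only [map_mul, map_pow, mul_pow]
          ring
        simp only [this]
        rw [← Finset.mul_sum, hsum p hp' hpm, mul_zero]
    have hs2 := congrArg Complex.re hs
    rw [Complex.re_sum, Complex.zero_re, Finset.sum_eq_zero_iff_of_nonneg] at hs2
    · simpa using hs2 0 (by simp)
    · intro j _
      exact hre _ (by simp [hω, hη1])
  let Q : Polynomial ℂ := ∑ p ∈ Finset.range (n + 1), Polynomial.C (c p) * Polynomial.X ^ p
  have hQ : Q = 0 := by
    apply Polynomial.eq_zero_of_infinite_isRoot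
    have hinf : Set.Infinite (Metric.sphere (0 : ℂ) 1) := by
      intro hfin
      refine ((isPreconnected_sphere (E := ℂ) (by simp) 0 1).infinite_of_nontrivial ?_) hfin
      refine ⟨1, by simp, -1, by simp, ?_⟩
      norm_num [Complex.ext_iff]
    refine hinf.mono fun x hx => ?_
    have hx1 : ‖x‖ = 1 := by simpa using hx
    obtain ⟨ω, hω⟩ : ∃ ω : ℂ, ω ^ 2 = x := IsAlgClosed.exists_pow_nat_eq x (by norm_num)
    have hω1 : ‖ω‖ = 1 := by
      have : ‖ω‖ ^ 2 = 1 := by rw [← norm_pow, hω, hx1]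
      nlinarith [norm_nonneg ω]
    have hPω : P ω = 0 := Complex.ext (hre0 ω hω1) (him ω hω1)
    have : Q.eval x = P ω * ω ^ n := by
      simp only [Q, hP, Polynomial.eval_finsetSum, Finset.sum_mul]
      refine Finset.sum_congr rfl fun p hp => ?_
      have hp' : p ≤ n := by simpa [Nat.lt_succ_iff] using hp
      rw [mul_assoc, hqz ω hω1 p hp', hω]; simp
    show Q.eval x = 0
    rw [this, hPω, zero_mul]
  intro p hp
  have := congrArg (fun R => Polynomial.coeff R p) hQ
  simp [Q, Polynomial.coeff_C_mul, Polynomial.coeff_X_pow] at this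
  exact this (by omega)

/-- With `φ(z,w) = ∑_{p+q=n} φ^{(p,q)}(z) w^p conj(w)^q + O(|w|^{n+1})` smooth and
plurisubharmonic, `n = 2m` even, if `φ^{(m,m)}` is constant on `U₀` then the complex
Hessian form `∑ ξν conj(ξμ) ∂²φ^{(p,q)}/∂zν∂z̄μ` vanishes on `U₀` for `(p,q) = (m,m)`
and moreover for every pair `(p,q)` with `p + q = n`. -/
theorem stmt12 {d : ℕ} (U : Set ((Fin d → ℂ) × ℂ)) (hU : IsOpen U)
    (U₀ : Set (Fin d → ℂ)) (hU₀ : IsOpen U₀) (hsub : ∀ z ∈ U₀, ((z, (0 : ℂ)) ∈ U))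
    (n m : ℕ) (hm : 1 ≤ m) (hnm : n = 2 * m)
    (φ : (Fin d → ℂ) × ℂ → ℝ) (hsm : ContDiffOn ℝ (⊤ : ℕ∞) φ U) (hpsh : PSHOn φ U)
    (φc : ℕ → (Fin d → ℂ) → ℂ) (hφc : ∀ p, ContDiff ℝ (⊤ : ℕ∞) (φc p))
    (hexp : ∀ z₀ ∈ U₀,
      ∃ C > (0 : ℝ), ∃ r > (0 : ℝ), ∀ (z : Fin d → ℂ) (w : ℂ),
        ‖z - z₀‖ < r → ‖w‖ < r → (z, w) ∈ U →
        ‖(φ (z, w) : ℂ) - ∑ p ∈ Finset.range (n + 1),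
            φc p z * w ^ p * (starRingEnd ℂ w) ^ (n - p)‖ ≤ C * ‖w‖ ^ (n + 1))
    (hconst : ∃ A : ℂ, ∀ z ∈ U₀, φc m z = A) :
    ∀ p ≤ n, ∀ z ∈ U₀, ∀ ξ : Fin d → ℂ, cHess (φc p) z ξ ξ = 0 := by
  intro p hp z hz ξ
  obtain ⟨C, hC, r, hr, hest⟩ := hexp z hz
  obtain ⟨r₁, hr₁, hballU⟩ := Metric.isOpen_iff.1 hU _ (hsub z hz)
  obtain ⟨R, hRd⟩ : ∃ R, R = min r r₁ := ⟨_, rfl⟩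
  have hR : 0 < R := hRd ▸ lt_min hr hr₁
  have hRr : R ≤ r := hRd ▸ min_le_left _ _
  have hRr₁ : R ≤ r₁ := hRd ▸ min_le_right _ _
  obtain ⟨ρ₀, hρd⟩ : ∃ ρ₀, ρ₀ = R / (2 * (‖ξ‖ + 1)) := ⟨_, rfl⟩
  have hρ₀ : 0 < ρ₀ := by rw [hρd]; positivity
  have htξ : ∀ t ∈ Metric.closedBall (0 : ℂ) ρ₀, ‖t • ξ‖ < R := by
    intro t ht
    have ht' : ‖t‖ ≤ ρ₀ := by simpa using ht
    rw [norm_smul]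
    have h1 : ρ₀ * (‖ξ‖ + 1) = R / 2 := by rw [hρd]; field_simp
    nlinarith [norm_nonneg ξ, norm_nonneg t]
  have hmemU : ∀ t ∈ Metric.closedBall (0 : ℂ) ρ₀, ∀ w : ℂ, ‖w‖ < R → (z + t • ξ, w) ∈ U := by
    intro t ht w hw
    apply hballU
    rw [mem_ball_iff_norm]
    have : (z + t • ξ, w) - (z, (0 : ℂ)) = (t • ξ, w) := by simp
    rw [this, Prod.norm_def]
    exact max_lt ((htξ t ht).trans_le hRr₁) (hw.trans_le hRr₁)
  have hφ2 : ∀ x ∈ U, ContDiffAt ℝ 2 (fun y => (φ y : ℂ)) x := by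
    intro x hx
    have h1 : ContDiffAt ℝ 2 φ x :=
      (hsm.contDiffAt (hU.mem_nhds hx)).of_le (WithTop.coe_le_coe.2 (le_top : (2 : ℕ∞) ≤ ⊤))
    exact Complex.ofRealCLM.contDiff.contDiffAt.comp x h1
  have hc2 : ∀ p, ContDiffAt ℝ 2 (φc p) z := fun p =>
    (hφc p).contDiffAt.of_le (WithTop.coe_le_coe.2 (le_top : (2 : ℕ∞) ≤ ⊤))
  let F : ℂ → (Fin d → ℂ) → ℂ := fun ω x => ∑ p ∈ Finset.range (n + 1),
    φc p x * (ω ^ p * (starRingEnd ℂ ω) ^ (n - p))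
  have hF2 : ∀ ω, ContDiffAt ℝ 2 (F ω) z := by
    intro ω
    exact ContDiffAt.sum fun p _ => (hc2 p).mul contDiffAt_const
  have hFH : ∀ ω, cHess (F ω) z ξ ξ = ∑ p ∈ Finset.range (n + 1),
      cHess (φc p) z ξ ξ * (ω ^ p * (starRingEnd ℂ ω) ^ (n - p)) := by
    intro ω
    have h1 := aux_four (hF2 ω) ξ
    have h2 := tendsto_finsetSum (Finset.range (n + 1)) fun p _ =>
      (aux_four (hc2 p) ξ).mul_const (ω ^ p * (starRingEnd ℂ ω) ^ (n - p))
    have h3 := tendsto_nhds_unique h1 (h2.congr fun s => ?_)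
    · have h4 : (4 : ℂ) ≠ 0 := by norm_num
      apply mul_left_cancel₀ h4
      rw [h3, Finset.mul_sum]
      exact Finset.sum_congr rfl fun p _ => by ring
    · simp only [F, Finset.mul_sum, ← Finset.sum_add_distrib, ← Finset.sum_sub_distrib,
        Finset.sum_div]
      exact Finset.sum_congr rfl fun p _ => by ring
  have hkey : ∀ ω : ℂ, ‖ω‖ = 1 → ∀ s : ℝ, 0 < s → s < R → ∀ t ∈ Metric.closedBall (0 : ℂ) ρ₀,
      ‖((φ (z + t • ξ, s * ω) / s ^ n : ℝ) : ℂ) - F ω (z + t • ξ)‖ ≤ C * s := by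
    intro ω hω s hs hsR t ht
    have hn : ‖(s : ℂ) * ω‖ = s := by simp [hω, abs_of_pos hs]
    have h1 := hest (z + t • ξ) (s * ω) (by simpa using (htξ t ht).trans_le hRr)
      (by rw [hn]; exact hsR.trans_le hRr) (hmemU t ht _ (by rw [hn]; exact hsR))
    rw [hn] at h1
    have hs0 : (s : ℂ) ≠ 0 := by exact_mod_cast hs.ne'
    have h2 : (φ (z + t • ξ, s * ω) : ℂ) - ∑ p ∈ Finset.range (n + 1), φc p (z + t • ξ)
        * ((s : ℂ) * ω) ^ p * (starRingEnd ℂ ((s : ℂ) * ω)) ^ (n - p)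
        = (s : ℂ) ^ n * (((φ (z + t • ξ, s * ω) / s ^ n : ℝ) : ℂ) - F ω (z + t • ξ)) := by
      rw [mul_sub]
      congr 1
      · push_cast; field_simp
      · simp only [F, Finset.mul_sum]
        refine Finset.sum_congr rfl fun p hp => ?_
        have hp' : p ≤ n := by simpa [Nat.lt_succ_iff] using hp
        have : (s : ℂ) ^ n = (s : ℂ) ^ p * (s : ℂ) ^ (n - p) := by
          rw [← pow_add, Nat.add_sub_cancel' hp']
        rw [this, map_mul, Complex.conj_ofReal, mul_pow, mul_pow]
        ring
    rw [h2, norm_mul, norm_pow, Complex.norm_real, Real.norm_eq_abs, abs_of_pos hs, pow_succ] at h1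
    have : 0 < s ^ n := by positivity
    nlinarith
  have hs_ex : ∀ δ > 0, ∃ s : ℝ, 0 < s ∧ s < R ∧ C * s ≤ δ := by
    intro δ hδ
    refine ⟨min (R / 2) (δ / C), lt_min (by linarith) (by positivity),
      lt_of_le_of_lt (min_le_left _ _) (by linarith), ?_⟩
    calc C * min (R / 2) (δ / C) ≤ C * (δ / C) := by gcongr; exact min_le_right _ _
      _ = δ := by field_simp
  have hre : ∀ ω : ℂ, ‖ω‖ = 1 → 0 ≤ (cHess (F ω) z ξ ξ).re := by
    intro ω hω
    refine aux_pos (hF2 ω) ξ Complex.reCLM ρ₀ hρ₀ fun δ hδ => ?_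
    obtain ⟨s, hs, hsR, hsδ⟩ := hs_ex δ hδ
    have hn : ‖(s : ℂ) * ω‖ = s := by simp [hω, abs_of_pos hs]
    refine ⟨fun t => φ (z + t • ξ, s * ω) / s ^ n, ?_, ?_, ?_⟩
    · refine ContinuousOn.div_const ?_ _
      refine hsm.continuousOn.comp (f := fun t : ℂ => (z + t • ξ, (s : ℂ) * ω)) ?_ ?_
      · fun_prop
      · intro t ht
        exact hmemU t ht _ (by rw [hn]; exact hsR)
    · intro t ht
      have hU' := hmemU t (Metric.ball_subset_closedBall ht) (s * ω) (by rw [hn]; exact hsR)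
      have h1 := aux_four (hφ2 _ hU') ((ξ, 0) : (Fin d → ℂ) × ℂ)
      have h2 := ((Complex.continuous_re.tendsto _).comp h1).div_const (s ^ n)
      refine ⟨_, ?_, h2.congr fun x => ?_⟩
      · have := hpsh _ hU' (ξ, 0)
        have h4 : (4 * cHess (fun y => (φ y : ℂ)) (z + t • ξ, s * ω) (ξ, 0) (ξ, 0)).re
            = 4 * (cHess (fun y => (φ y : ℂ)) (z + t • ξ, s * ω) (ξ, 0) (ξ, 0)).re := by
          simp
        rw [h4]
        positivity
      · have q1 : (z + (t + x) • ξ, (s : ℂ) * ω)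
            = (z + t • ξ, (s : ℂ) * ω) + x • ((ξ, 0) : (Fin d → ℂ) × ℂ) := by
          ext <;> simp; ring
        have q2 : (z + (t - x) • ξ, (s : ℂ) * ω)
            = (z + t • ξ, (s : ℂ) * ω) - x • ((ξ, 0) : (Fin d → ℂ) × ℂ) := by
          ext <;> simp; ring
        have q3 : (z + (t + x * I) • ξ, (s : ℂ) * ω)
            = (z + t • ξ, (s : ℂ) * ω) + x • (I • ((ξ, 0) : (Fin d → ℂ) × ℂ)) := by
          ext <;> simp; ring
        have q4 : (z + (t - x * I) • ξ, (s : ℂ) * ω)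
            = (z + t • ξ, (s : ℂ) * ω) - x • (I • ((ξ, 0) : (Fin d → ℂ) × ℂ)) := by
          ext <;> simp; ring
        beta_reduce
        rw [q1, q2, q3, q4]
        simp only [Function.comp]
        norm_cast
        ring
    · intro t ht
      have h1 := (Complex.abs_re_le_norm _).trans (hkey ω hω s hs hsR t ht)
      rw [Complex.sub_re, Complex.ofReal_re] at h1
      exact h1.trans hsδ
  have himz : ∀ ω : ℂ, ‖ω‖ = 1 → ∀ δ > 0, ∀ t ∈ Metric.closedBall (0 : ℂ) ρ₀,
      |(F ω (z + t • ξ)).im| ≤ δ := by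
    intro ω hω δ hδ t ht
    obtain ⟨s, hs, hsR, hsδ⟩ := hs_ex δ hδ
    have h1 := (Complex.abs_im_le_norm _).trans (hkey ω hω s hs hsR t ht)
    rw [Complex.sub_im, Complex.ofReal_im, zero_sub, abs_neg] at h1
    exact h1.trans hsδ
  have him : ∀ ω : ℂ, ‖ω‖ = 1 → (cHess (F ω) z ξ ξ).im = 0 := by
    intro ω hω
    have h1 := aux_pos (hF2 ω) ξ Complex.imCLM ρ₀ hρ₀ fun δ hδ =>
      ⟨fun _ => 0, continuousOn_const, fun t _ => ⟨0, le_rfl, by simp⟩, fun t ht => by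
        simpa using himz ω hω δ hδ t ht⟩
    have h2 := aux_pos (hF2 ω) ξ (-Complex.imCLM) ρ₀ hρ₀ fun δ hδ =>
      ⟨fun _ => 0, continuousOn_const, fun t _ => ⟨0, le_rfl, by simp⟩, fun t ht => by
        simpa using himz ω hω δ hδ t ht⟩
    simp at h1 h2
    exact le_antisymm h2 h1
  have hcm : cHess (φc m) z ξ ξ = 0 := by
    obtain ⟨A, hA⟩ := hconst
    have hev : φc m =ᶠ[nhds z] fun _ => A := by
      filter_upwards [hU₀.mem_nhds hz] with y hy using hA y hy
    rw [aux_cHess (hc2 m)]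
    have : fderiv ℝ (fderiv ℝ (φc m)) z = 0 := by
      rw [hev.fderiv.fderiv_eq]; simp
    simp [this]
  refine aux_trig n m hnm (fun p => cHess (φc p) z ξ ξ) hcm ?_ ?_ p hp
  · intro ω hω
    rw [← hFH]; exact hre ω hω
  · intro ω hω
    rw [← hFH]; exact him ω hω
end

section
/- Let U ⊆ ℂ^d × ℂ be open with coordinates (z, w), n ≥ 2 an integer, A ≥ 0 constants A^{(p,q)} for p, q > 0 with p + q = n, and φ a smooth plurisubharmonic function on U of the form φ(z,w) = Σ_{p,q>0, p+q=n} A^{(p,q)} w^p conj(w)^q + φ^{(n,0)}(z) w^n + conj(φ^{(n,0)}(z)) conj(w)^n + O(|w|^{n+1}) with φ^{(n,0)} smooth. Then φ^{(n,0)} is holomorphic in z. -/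
open Complex

theorem two_le_smooth : (2 : WithTop ℕ∞) ≤ ((⊤ : ℕ∞) : WithTop ℕ∞) := by
  have : ((2 : ℕ∞) : WithTop ℕ∞) ≤ ((⊤ : ℕ∞) : WithTop ℕ∞) := WithTop.coe_le_coe.2 le_top
  exact this

noncomputable def D2 {E F : Type*} [NormedAddCommGroup E] [NormedSpace ℝ E]
    [NormedAddCommGroup F] [NormedSpace ℝ F] (f : E → F) (x v : E) : F :=
  deriv (deriv (fun t : ℝ => f (x + t • v))) 0

section
variable {E F : Type*} [NormedAddCommGroup E] [NormedSpace ℝ E]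
    [NormedAddCommGroup F] [NormedSpace ℝ F]

theorem line_hasDerivAt {f : E → F} {x v : E} {t : ℝ} (hf : DifferentiableAt ℝ f (x + t • v)) :
    HasDerivAt (fun t : ℝ => f (x + t • v)) (fderiv ℝ f (x + t • v) v) t := by
  have h1 : HasDerivAt (fun t : ℝ => x + t • v) v t := by
    simpa using ((hasDerivAt_id t).smul_const v).const_add x
  exact hf.hasFDerivAt.comp_hasDerivAt t h1

theorem line_tendsto (x v : E) : Filter.Tendsto (fun t : ℝ => x + t • v) (nhds 0) (nhds x) := by
  have : Continuous (fun t : ℝ => x + t • v) := by fun_prop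
  simpa using this.tendsto 0

theorem line_deriv_ev {f : E → F} {x v : E} (hf : ContDiffAt ℝ 2 f x) :
    deriv (fun t : ℝ => f (x + t • v)) =ᶠ[nhds 0] fun t => fderiv ℝ f (x + t • v) v := by
  have h := (hf.eventually (by simp)).mono (fun y hy => hy.differentiableAt (by norm_num))
  filter_upwards [(line_tendsto x v).eventually h] with t ht
  exact (line_hasDerivAt ht).deriv

theorem fderiv_diff {f : E → F} {x : E} (hf : ContDiffAt ℝ 2 f x) :
    DifferentiableAt ℝ (fderiv ℝ f) x :=
  (hf.fderiv_right (m := 1) (by norm_num)).differentiableAt (by norm_num)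

theorem line_hasDerivAt2 {f : E → F} {x v : E} (hf : ContDiffAt ℝ 2 f x) :
    HasDerivAt (deriv (fun t : ℝ => f (x + t • v))) (fderiv ℝ (fderiv ℝ f) x v v) 0 := by
  refine HasDerivAt.congr_of_eventuallyEq ?_ (line_deriv_ev hf)
  have h := line_hasDerivAt (f := fderiv ℝ f) (x := x) (v := v) (t := 0)
    (by simpa using fderiv_diff hf)
  have := h.clm_apply (hasDerivAt_const (0:ℝ) v)
  simpa using this

theorem D2_eq {f : E → F} {x : E} (v : E) (hf : ContDiffAt ℝ 2 f x) :
    D2 f x v = fderiv ℝ (fderiv ℝ f) x v v := (line_hasDerivAt2 hf).deriv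

theorem D2_add {f g : E → F} {x : E} (v : E) (hf : ContDiffAt ℝ 2 f x) (hg : ContDiffAt ℝ 2 g x) :
    D2 (fun y => f y + g y) x v = D2 f x v + D2 g x v := by
  have hfe := (hf.eventually (by simp)).mono (fun y hy => hy.differentiableAt (by norm_num))
  have hge := (hg.eventually (by simp)).mono (fun y hy => hy.differentiableAt (by norm_num))
  have : fderiv ℝ (fun y => f y + g y) =ᶠ[nhds x] fun y => fderiv ℝ f y + fderiv ℝ g y := by
    filter_upwards [hfe, hge] with y h1 h2
    exact fderiv_fun_add h1 h2
  rw [D2_eq v (hf.add hg), D2_eq v hf, D2_eq v hg, this.fderiv_eq,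
    fderiv_fun_add (fderiv_diff hf) (fderiv_diff hg)]
  simp

theorem D2_clm {G : Type*} [NormedAddCommGroup G] [NormedSpace ℝ G] (L : F →L[ℝ] G)
    {f : E → F} {x : E} (v : E) (hf : ContDiffAt ℝ 2 f x) :
    D2 (fun y => L (f y)) x v = L (D2 f x v) := by
  have h := (hf.eventually (by simp)).mono (fun y hy => hy.differentiableAt (by norm_num))
  have h1 : deriv (fun t : ℝ => L (f (x + t • v))) =ᶠ[nhds 0]
      fun t => L (deriv (fun t : ℝ => f (x + t • v)) t) := by
    filter_upwards [(line_tendsto x v).eventually h] with t ht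
    have := (line_hasDerivAt (v := v) (x := x) (t := t) ht)
    rw [this.deriv]
    exact (L.hasFDerivAt.comp_hasDerivAt t this).deriv
  unfold D2
  rw [h1.deriv_eq, (line_hasDerivAt2 hf).deriv]
  exact (L.hasFDerivAt.comp_hasDerivAt (0:ℝ) (line_hasDerivAt2 (v := v) hf)).deriv

theorem D2_smul {f : E → F} {x : E} (s : ℝ) (v : E) (hf : ContDiffAt ℝ 2 f x) :
    D2 f x (s • v) = s ^ 2 • D2 f x v := by
  rw [D2_eq _ hf, D2_eq _ hf]
  simp [smul_smul, sq]

theorem D2_nonpos_of_max {f : E → ℝ} {x : E} (v : E) (hf : ContDiffAt ℝ 2 f x)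
    (hm : IsLocalMax f x) : D2 f x v ≤ 0 := by
  by_contra! hpos
  set g := fun t : ℝ => f (x + t • v) with hg
  have hmg : IsLocalMax g 0 := by
    have := (line_tendsto x v).eventually hm
    filter_upwards [this] with t ht
    simpa [hg] using ht
  have hd : deriv g 0 = 0 := hmg.deriv_eq_zero
  have hc : ContinuousAt g 0 := by
    have : ContinuousAt f (x + (0:ℝ) • v) := by simpa using hf.continuousAt
    exact ContinuousAt.comp (f := fun t : ℝ => x + t • v) (g := f) this
      (by fun_prop)
  have hmin : IsLocalMin g 0 := isLocalMin_of_deriv_deriv_pos hpos hd hc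
  have heq : g =ᶠ[nhds 0] fun _ => g 0 := by
    filter_upwards [hmg, hmin] with t h1 h2
    exact le_antisymm h1 h2
  have : deriv (deriv g) 0 = 0 := by
    rw [(heq.deriv).deriv_eq]; simp
  exact absurd hpos (by change ¬ 0 < deriv (deriv g) 0; rw [this]; simp)

end

theorem max_princ (k : ℂ → ℝ) (ρ : ℝ) (hρ : 0 < ρ)
    (hk : ∀ ζ : ℂ, ‖ζ‖ ≤ ρ → ContDiffAt ℝ 2 k ζ)
    (hL : ∀ ζ : ℂ, ‖ζ‖ ≤ ρ → 0 < D2 k ζ 1 + D2 k ζ Complex.I) :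
    ∃ ζ : ℂ, ‖ζ‖ = ρ ∧ k 0 ≤ k ζ := by
  obtain ⟨ζ, hζ, hmax⟩ := (isCompact_closedBall (0:ℂ) ρ).exists_isMaxOn
    ⟨0, by simp [hρ.le]⟩ (fun ζ hζ => (hk ζ (by simpa using hζ)).continuousAt.continuousWithinAt)
  have hζ' : ‖ζ‖ ≤ ρ := by simpa using hζ
  rcases hζ'.lt_or_eq with h | h
  · exfalso
    have hm : IsLocalMax k ζ := by
      have : Metric.closedBall (0:ℂ) ρ ∈ nhds ζ :=
        Filter.mem_of_superset (Metric.isOpen_ball.mem_nhds (by simpa using h))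
          Metric.ball_subset_closedBall
      exact hmax.isLocalMax this
    have h1 := D2_nonpos_of_max 1 (hk ζ hζ') hm
    have h2 := D2_nonpos_of_max Complex.I (hk ζ hζ') hm
    linarith [hL ζ hζ']
  · exact ⟨ζ, h, hmax (by simp [hρ.le])⟩

theorem psh_D2 {E : Type*} [NormedAddCommGroup E] [NormedSpace ℂ E]
    (φ : E → ℝ) (x v : E) (hf : ContDiffAt ℝ 2 φ x)
    (h : 0 ≤ (cHess (fun x => (φ x : ℂ)) x v v).re) :
    0 ≤ D2 φ x v + D2 φ x (Complex.I • v) := by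
  have hd := (hf.eventually (by simp)).mono (fun y hy => hy.differentiableAt (by norm_num))
  have h1 : (fun y => wBarDeriv (fun x => (φ x : ℂ)) y v) =ᶠ[nhds x]
      fun y => ((fderiv ℝ φ y v : ℝ) + Complex.I * (fderiv ℝ φ y (Complex.I • v) : ℝ)) / 2 := by
    filter_upwards [hd] with y hy
    have : fderiv ℝ (fun x => (φ x : ℂ)) y = Complex.ofRealCLM.comp (fderiv ℝ φ y) :=
      (Complex.ofRealCLM.hasFDerivAt.comp y hy.hasFDerivAt).fderiv
    simp [wBarDeriv, this]
  have hF := (fderiv_diff hf).hasFDerivAt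
  have hA : ∀ u : E, HasFDerivAt (fun y => ((fderiv ℝ φ y u : ℝ) : ℂ))
      (Complex.ofRealCLM.comp ((ContinuousLinearMap.apply ℝ ℝ u).comp (fderiv ℝ (fderiv ℝ φ) x))) x := by
    intro u
    have h2 := (ContinuousLinearMap.apply ℝ ℝ u).hasFDerivAt.comp x hF
    exact Complex.ofRealCLM.hasFDerivAt.comp x h2
  have hB : HasFDerivAt (fun y => ((fderiv ℝ φ y v : ℝ) +
      Complex.I * (fderiv ℝ φ y (Complex.I • v) : ℝ)) / 2 : E → ℂ) _ x :=
    ((hA v).add ((hA (Complex.I • v)).const_mul Complex.I)).mul_const (2:ℂ)⁻¹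
  rw [cHess, wDeriv, h1.fderiv_eq, hB.fderiv] at h
  rw [D2_eq _ hf, D2_eq _ hf]
  simp at h
  linarith

theorem D2_prod (ψ : ℂ → ℂ) (hψ : ContDiff ℝ 2 ψ) (w b e : ℂ) (n : ℕ) :
    D2 (fun ζ : ℂ => ψ ζ * (w + ζ * b) ^ n) 0 e =
      D2 ψ 0 e * w ^ n + 2 * (fderiv ℝ ψ 0 e * (n * w ^ (n - 1) * (e * b)))
        + ψ 0 * (n * ((n - 1 : ℕ) * w ^ (n - 1 - 1)) * b ^ 2) * e ^ 2 := by
  have hu : ∀ t : ℝ, HasDerivAt (fun t : ℝ => w + (0 + t • e) * b) (e * b) t := by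
    intro t
    have := (((hasDerivAt_id t).ofReal_comp.mul_const e).mul_const b).const_add w
    simpa using this
  have hup : ∀ (m : ℕ) (t : ℝ), HasDerivAt (fun t : ℝ => (w + (0 + t • e) * b) ^ m)
      (m * (w + (0 + t • e) * b) ^ (m - 1) * (e * b)) t := fun m t => (hu t).fun_pow m
  have hp : ∀ t : ℝ, HasDerivAt (fun t : ℝ => ψ (0 + t • e)) (fderiv ℝ ψ (0 + t • e) e) t :=
    fun t => line_hasDerivAt (hψ.differentiable (by norm_num) _)
  have h1 : deriv (fun t : ℝ => ψ (0 + t • e) * (w + (0 + t • e) * b) ^ n) =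
      fun t : ℝ => fderiv ℝ ψ (0 + t • e) e * (w + (0 + t • e) * b) ^ n +
        ψ (0 + t • e) * (n * (w + (0 + t • e) * b) ^ (n - 1) * (e * b)) := by
    funext t
    exact ((hp t).mul (hup n t)).deriv
  have hpp : HasDerivAt (fun t : ℝ => fderiv ℝ ψ (0 + t • e) e) (D2 ψ 0 e) 0 := by
    have := line_hasDerivAt2 (v := e) (hψ.contDiffAt (x := 0))
    rw [← D2_eq e hψ.contDiffAt] at this
    refine this.congr_of_eventuallyEq ?_
    exact (line_deriv_ev hψ.contDiffAt).symm
  unfold D2 at *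
  rw [h1]
  have h2 := (hpp.mul (hup n 0)).add ((hp 0).mul (((hup (n-1) 0).const_mul (n:ℂ)).mul_const (e * b)))
  refine h2.deriv.trans ?_
  simp
  ring

theorem D2_cont (G : ℂ → ℝ) (hG : ContDiff ℝ 2 G) (e : ℂ) : Continuous (fun ζ => D2 G ζ e) := by
  have : (fun ζ => D2 G ζ e) = fun ζ => fderiv ℝ (fderiv ℝ G) ζ e e :=
    funext fun ζ => D2_eq e hG.contDiffAt
  rw [this]
  have h1 : ContDiff ℝ 1 (fderiv ℝ G) := hG.fderiv_right (by norm_num)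
  have h2 : Continuous (fderiv ℝ (fderiv ℝ G)) := h1.continuous_fderiv (by norm_num)
  exact (h2.clm_apply continuous_const).clm_apply continuous_const

theorem D2_normSq (ζ : ℂ) (e : ℂ) : D2 (fun z : ℂ => Complex.normSq z) ζ e = 2 * Complex.normSq e := by
  have h : (fun t : ℝ => Complex.normSq (ζ + t • e)) = fun t : ℝ => Complex.normSq ζ +
     t * (2 * (ζ.re * e.re + ζ.im * e.im)) + t ^ 2 * Complex.normSq e := by
    funext t; simp [Complex.normSq_apply]; ring
  unfold D2
  rw [h]
  have h1 : deriv (fun t : ℝ => Complex.normSq ζ +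
     t * (2 * (ζ.re * e.re + ζ.im * e.im)) + t ^ 2 * Complex.normSq e) =
     fun t => (2 * (ζ.re * e.re + ζ.im * e.im)) + 2 * t * Complex.normSq e := by
    funext t
    have := (((hasDerivAt_id t).mul_const (2 * (ζ.re * e.re + ζ.im * e.im))).const_add
      (Complex.normSq ζ)).add (((hasDerivAt_id t).pow 2).mul_const (Complex.normSq e))
    refine this.deriv.trans ?_
    simp
  rw [h1]
  have := ((((hasDerivAt_id (0:ℝ)).const_mul 2).mul_const (Complex.normSq e))).const_add
    (2 * (ζ.re * e.re + ζ.im * e.im))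
  refine this.deriv.trans ?_
  simp

theorem contDiff_normSq : ContDiff ℝ 2 (fun z : ℂ => Complex.normSq z) := by
  have : (fun z : ℂ => Complex.normSq z) = fun z => z.re * z.re + z.im * z.im := by
    funext z; exact Complex.normSq_apply z
  rw [this]
  exact (Complex.reCLM.contDiff.mul Complex.reCLM.contDiff).add
    (Complex.imCLM.contDiff.mul Complex.imCLM.contDiff)

/-- Stability of subharmonicity under uniform limits, in the form needed here. -/
theorem limit_subharm (G : ℂ → ℝ) (hG : ContDiff ℝ 2 G) (ρ₀ : ℝ) (hρ₀ : 0 < ρ₀)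
    (happ : ∀ η > (0:ℝ), ∃ F : ℂ → ℝ, ∀ ζ : ℂ, ‖ζ‖ ≤ ρ₀ → ContDiffAt ℝ 2 F ζ ∧
      0 ≤ D2 F ζ 1 + D2 F ζ Complex.I ∧ |F ζ - G ζ| ≤ η) :
    0 ≤ D2 G 0 1 + D2 G 0 Complex.I := by
  by_contra! hneg
  set δ := -(D2 G 0 1 + D2 G 0 Complex.I) / 8 with hδ
  have hδ0 : 0 < δ := by rw [hδ]; linarith
  have hc : Continuous (fun ζ => D2 G ζ 1 + D2 G ζ Complex.I) :=
    (D2_cont G hG 1).add (D2_cont G hG Complex.I)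
  have hev : ∀ᶠ ζ in nhds (0:ℂ), D2 G ζ 1 + D2 G ζ Complex.I < -(4 * δ) :=
    hc.continuousAt.eventually_lt continuousAt_const (by rw [hδ]; linarith)
  obtain ⟨ρ₁, hρ₁, hball⟩ := Metric.eventually_nhds_iff.1 hev
  set ρ := min ρ₀ (ρ₁ / 2) with hρd
  have hρ : 0 < ρ := lt_min hρ₀ (by linarith)
  obtain ⟨F, hF⟩ := happ (δ * ρ ^ 2 / 4) (by positivity)
  have hle : ∀ ζ : ℂ, ‖ζ‖ ≤ ρ → ‖ζ‖ ≤ ρ₀ := fun ζ h => h.trans (min_le_left _ _)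
  have hcG : ∀ ζ : ℂ, ContDiffAt ℝ 2 (fun ζ => (-1:ℝ) * G ζ + (-δ) * Complex.normSq ζ) ζ :=
    fun ζ => ((contDiff_const.mul hG).add (contDiff_const.mul contDiff_normSq)).contDiffAt
  obtain ⟨ζ, hζ, hk⟩ := max_princ (fun ζ => F ζ + ((-1:ℝ) * G ζ + (-δ) * Complex.normSq ζ)) ρ hρ
    (fun ζ h => (hF ζ (hle ζ h)).1.add (hcG ζ)) (by
      intro ζ h
      have key : ∀ e : ℂ, D2 (fun ζ => F ζ + ((-1:ℝ) * G ζ + (-δ) * Complex.normSq ζ)) ζ e =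
          D2 F ζ e + (-1 * D2 G ζ e + (-δ) * (2 * Complex.normSq e)) := by
        intro e
        rw [D2_add e (hF ζ (hle ζ h)).1 (hcG ζ),
          D2_add e (contDiff_const.mul hG).contDiffAt (contDiff_const.mul contDiff_normSq).contDiffAt]
        have h1 := D2_clm ((-1:ℝ) • ContinuousLinearMap.id ℝ ℝ) e (hG.contDiffAt (x := ζ))
        have h2 := D2_clm ((-δ) • ContinuousLinearMap.id ℝ ℝ) e (contDiff_normSq.contDiffAt (x := ζ))
        rw [D2_normSq] at h2
        simp only [smul_apply, ContinuousLinearMap.id_apply, smul_eq_mul] at h1 h2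
        rw [h1, h2]
      rw [key, key]
      have := hball (y := ζ) (by
        rw [dist_zero_right]
        have := min_le_right ρ₀ (ρ₁ / 2)
        linarith)
      have := (hF ζ (hle ζ h)).2.1
      simp
      linarith)
  have h0 := abs_le.1 (hF 0 (by simpa using hρ₀.le)).2.2
  have h1 := abs_le.1 (hF ζ (hle ζ hζ.le)).2.2
  simp only [Complex.normSq_eq_norm_sq, hζ, norm_zero] at hk
  have : 0 < δ * ρ ^ 2 := by positivity
  nlinarith

noncomputable def qpoly (n : ℕ) (A : ℕ → ℝ) (w : ℂ) : ℝ :=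
  (∑ p ∈ Finset.Ioo 0 n, (A p : ℂ) * w ^ p * (starRingEnd ℂ w) ^ (n - p)).re

theorem qpoly_contDiff (n : ℕ) (A : ℕ → ℝ) : ContDiff ℝ 2 (qpoly n A) := by
  have h : ContDiff ℝ 2 (fun w : ℂ =>
      ∑ p ∈ Finset.Ioo 0 n, (A p : ℂ) * w ^ p * (starRingEnd ℂ w) ^ (n - p)) := by
    refine ContDiff.sum fun p _ => ?_
    exact (contDiff_const.mul (contDiff_id.pow p)).mul
      ((Complex.conjCLE.contDiff (n := 2)).pow (n - p))
  exact Complex.reCLM.contDiff.comp h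

theorem qpoly_hom (n : ℕ) (A : ℕ → ℝ) (ε : ℝ) (w : ℂ) :
    qpoly n A (ε * w) = ε ^ n * qpoly n A w := by
  unfold qpoly
  rw [← Complex.re_ofReal_mul, Finset.mul_sum]
  congr 1
  refine Finset.sum_congr rfl fun p hp => ?_
  have hp' : p ≤ n := (Finset.mem_Ioo.1 hp).2.le
  have : ((ε ^ n : ℝ) : ℂ) = (ε : ℂ) ^ p * (ε : ℂ) ^ (n - p) := by
    rw [← pow_add, Nat.add_sub_cancel' hp']; push_cast; rfl
  rw [this, map_mul, Complex.conj_ofReal, mul_pow, mul_pow]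
  ring

noncomputable def gfun {d : ℕ} (n : ℕ) (A : ℕ → ℝ) (φn0 : (Fin d → ℂ) → ℂ) (z₀ ξ : Fin d → ℂ)
    (w b : ℂ) (ζ : ℂ) : ℝ :=
  qpoly n A (w + ζ * b) + 2 * (φn0 (z₀ + ζ • ξ) * (w + ζ * b) ^ n).re

section
variable {d : ℕ} (n : ℕ) (A : ℕ → ℝ) (φn0 : (Fin d → ℂ) → ℂ) (z₀ ξ : Fin d → ℂ)

theorem psi_contDiff (hφ : ContDiff ℝ 2 φn0) : ContDiff ℝ 2 (fun ζ : ℂ => φn0 (z₀ + ζ • ξ)) :=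
  hφ.comp (contDiff_const.add (contDiff_id.smul contDiff_const))

theorem aff_contDiff (w b : ℂ) : ContDiff ℝ 2 (fun ζ : ℂ => w + ζ * b) :=
  contDiff_const.add (contDiff_id.mul contDiff_const)

theorem gfun_contDiff (hφ : ContDiff ℝ 2 φn0) (w b : ℂ) :
    ContDiff ℝ 2 (gfun n A φn0 z₀ ξ w b) := by
  refine ((qpoly_contDiff n A).comp (aff_contDiff w b)).add (contDiff_const.mul ?_)
  exact Complex.reCLM.contDiff.comp ((psi_contDiff φn0 z₀ ξ hφ).mul ((aff_contDiff w b).pow n))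

theorem gfun_D2 (hφ : ContDiff ℝ 2 φn0) (w b e : ℂ) :
    D2 (gfun n A φn0 z₀ ξ w b) 0 e = D2 (qpoly n A) w (e * b) +
      2 * (D2 (fun ζ : ℂ => φn0 (z₀ + ζ • ξ)) 0 e * w ^ n +
        2 * (fderiv ℝ φn0 z₀ (e • ξ) * (n * w ^ (n - 1) * (e * b)))
        + φn0 z₀ * (n * ((n - 1 : ℕ) * w ^ (n - 1 - 1)) * b ^ 2) * e ^ 2).re := by
  have hψ := psi_contDiff φn0 z₀ ξ hφ
  have hm : ContDiff ℝ 2 (fun ζ : ℂ => φn0 (z₀ + ζ • ξ) * (w + ζ * b) ^ n) :=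
    hψ.mul ((aff_contDiff w b).pow n)
  have h1 := D2_add (f := fun ζ => qpoly n A (w + ζ * b))
    (g := fun ζ : ℂ => ((2:ℝ) • Complex.reCLM) (φn0 (z₀ + ζ • ξ) * (w + ζ * b) ^ n)) (x := 0) e
    ((qpoly_contDiff n A).comp (aff_contDiff w b)).contDiffAt
    (((2:ℝ) • Complex.reCLM).contDiff.comp hm).contDiffAt
  refine h1.trans ?_
  rw [D2_clm _ e hm.contDiffAt, D2_prod _ hψ]
  have h2 : fderiv ℝ (fun ζ : ℂ => φn0 (z₀ + ζ • ξ)) 0 e = fderiv ℝ φn0 z₀ (e • ξ) := by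
    have ha : HasFDerivAt (fun ζ : ℂ => z₀ + ζ • ξ)
        ((ContinuousLinearMap.id ℝ ℂ).smulRight ξ) 0 := by
      exact ((ContinuousLinearMap.id ℝ ℂ).smulRight ξ).hasFDerivAt.const_add z₀
    have hb : HasFDerivAt φn0 (fderiv ℝ φn0 z₀) (z₀ + (0:ℂ) • ξ) := by
      simpa using (hφ.differentiable (by norm_num) z₀).hasFDerivAt
    have hcmp : HasFDerivAt (fun ζ : ℂ => φn0 (z₀ + ζ • ξ)) _ 0 := hb.comp (0:ℂ) ha
    rw [hcmp.fderiv]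
    simp
  have h3 : D2 (fun ζ => qpoly n A (w + ζ * b)) 0 e = D2 (qpoly n A) w (e * b) := by
    unfold D2
    congr 2
    funext t
    simp [mul_assoc]
  rw [h2, h3]
  simp

theorem gfun_lap (hφ : ContDiff ℝ 2 φn0) (w b : ℂ) :
    D2 (gfun n A φn0 z₀ ξ w b) 0 1 + D2 (gfun n A φn0 z₀ ξ w b) 0 Complex.I =
      (D2 (qpoly n A) w b + D2 (qpoly n A) w (Complex.I * b)) +
      2 * ((D2 (fun ζ : ℂ => φn0 (z₀ + ζ • ξ)) 0 1 + D2 (fun ζ : ℂ => φn0 (z₀ + ζ • ξ)) 0 Complex.I)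
          * w ^ n + 2 * n * (w ^ (n - 1) * b *
            (fderiv ℝ φn0 z₀ ξ + Complex.I * fderiv ℝ φn0 z₀ (Complex.I • ξ)))).re := by
  rw [gfun_D2 n A φn0 z₀ ξ hφ, gfun_D2 n A φn0 z₀ ξ hφ, Complex.I_sq, one_mul, one_smul]
  have : ∀ a b c d : ℝ, a + 2 * b + (c + 2 * d) = a + c + 2 * (b + d) := by intros; ring
  rw [this, ← Complex.add_re]
  congr 3
  ring

theorem approx (U : Set ((Fin d → ℂ) × ℂ)) (hU : IsOpen U)
    (φ : (Fin d → ℂ) × ℂ → ℝ) (hsm : ContDiffOn ℝ (⊤ : ℕ∞) φ U) (hpsh : PSHOn φ U)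
    (hz : (z₀, (0:ℂ)) ∈ U) (C : ℝ) (hC : 0 < C) (r : ℝ) (hr : 0 < r)
    (hexp : ∀ (z : Fin d → ℂ) (w : ℂ),
        ‖z - z₀‖ < r → ‖w‖ < r → (z, w) ∈ U →
        ‖(φ (z, w) : ℂ) -
            (∑ p ∈ Finset.Ioo 0 n, (A p : ℂ) * w ^ p * (starRingEnd ℂ w) ^ (n - p)
              + φn0 z * w ^ n + (starRingEnd ℂ (φn0 z)) * (starRingEnd ℂ w) ^ n)‖
          ≤ C * ‖w‖ ^ (n + 1)) :
    ∃ ρ₀ > (0:ℝ), ∀ w b : ℂ, ∀ η > (0:ℝ), ∃ F : ℂ → ℝ, ∀ ζ : ℂ, ‖ζ‖ ≤ ρ₀ → ContDiffAt ℝ 2 F ζ ∧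
      0 ≤ D2 F ζ 1 + D2 F ζ Complex.I ∧ |F ζ - gfun n A φn0 z₀ ξ w b ζ| ≤ η := by
  obtain ⟨r₁, hr₁, hball⟩ := Metric.isOpen_iff.1 hU _ hz
  set R := min r r₁ with hR
  have hR0 : 0 < R := lt_min hr hr₁
  refine ⟨R / (2 * (‖ξ‖ + 1)), by positivity, fun w b η hη => ?_⟩
  set ρ₀ := R / (2 * (‖ξ‖ + 1)) with hρ
  have hρ0 : 0 < ρ₀ := by positivity
  set M := ‖w‖ + ρ₀ * ‖b‖ + 1 with hM
  have hM0 : 0 < M := by positivity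
  obtain ⟨ε, hε, hε1, hε2⟩ : ∃ ε : ℝ, 0 < ε ∧ ε * M < R ∧ C * ε * M ^ (n + 1) ≤ η := by
    refine ⟨min (R / (2 * M)) (η / (C * M ^ (n + 1))), by positivity, ?_, ?_⟩
    · calc _ ≤ R / (2 * M) * M := by gcongr; exact min_le_left _ _
        _ = R / 2 := by field_simp
        _ < R := by linarith
    · calc _ ≤ C * (η / (C * M ^ (n + 1))) * M ^ (n + 1) := by gcongr; exact min_le_right _ _
        _ = η := by field_simp
  set T : ℂ → (Fin d → ℂ) × ℂ := fun ζ => (z₀ + ζ • ξ, (ε:ℂ) * (w + ζ * b)) with hT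
  refine ⟨fun ζ => (ε ^ n)⁻¹ * φ (T ζ), fun ζ hζ => ?_⟩
  have hu : ‖w + ζ * b‖ ≤ M := by
    calc _ ≤ ‖w‖ + ‖ζ‖ * ‖b‖ := by rw [← norm_mul]; exact norm_add_le _ _
      _ ≤ ‖w‖ + ρ₀ * ‖b‖ := by gcongr
      _ ≤ M := by linarith
  have h1 : ‖(z₀ + ζ • ξ) - z₀‖ < R := by
    rw [add_sub_cancel_left, norm_smul]
    calc _ ≤ ρ₀ * ‖ξ‖ := by gcongr
      _ ≤ ρ₀ * (‖ξ‖ + 1) := by gcongr; linarith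
      _ = R / 2 := by rw [hρ]; field_simp
      _ < R := by linarith
  have h2' : ‖(ε:ℂ) * (w + ζ * b)‖ = ε * ‖w + ζ * b‖ := by
    rw [norm_mul, Complex.norm_real, Real.norm_of_nonneg hε.le]
  have h2 : ‖(ε:ℂ) * (w + ζ * b)‖ < R := by
    rw [h2']
    exact lt_of_le_of_lt (by gcongr) hε1
  have hTU : T ζ ∈ U := by
    apply hball
    rw [Metric.mem_ball, Prod.dist_eq, dist_eq_norm, dist_eq_norm]
    refine max_lt (h1.trans_le (min_le_right _ _)) ?_
    simpa [hT] using h2.trans_le (min_le_right _ _)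
  have hφ2 : ContDiffAt ℝ 2 φ (T ζ) :=
    (hsm.contDiffAt (hU.mem_nhds hTU)).of_le two_le_smooth
  have hTs : ContDiff ℝ 2 T := (contDiff_const.add (contDiff_id.smul contDiff_const)).prodMk
    (contDiff_const.mul (aff_contDiff w b))
  have hcomp : ContDiffAt ℝ 2 (fun ζ => φ (T ζ)) ζ := hφ2.comp ζ hTs.contDiffAt
  refine ⟨contDiffAt_const.mul hcomp, ?_, ?_⟩
  · have hD : ∀ e : ℂ, D2 (fun ζ => (ε ^ n)⁻¹ * φ (T ζ)) ζ e =
        (ε ^ n)⁻¹ * D2 φ (T ζ) (e • (ξ, (ε:ℂ) * b)) := by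
      intro e
      have h := D2_clm (((ε ^ n)⁻¹ : ℝ) • ContinuousLinearMap.id ℝ ℝ) e hcomp
      simp only [smul_apply, ContinuousLinearMap.id_apply, smul_eq_mul] at h
      rw [h]
      congr 1
      unfold D2
      congr 2
      funext t
      congr 1
      simp only [hT, Prod.smul_mk, Prod.mk_add_mk, smul_eq_mul, Complex.real_smul]
      refine congrArg φ (Prod.ext ?_ ?_)
      · simp only [add_smul, add_assoc]
        congr 2
        rw [← Complex.real_smul, smul_assoc]
      · simp only
        ring
    rw [hD, hD, ← mul_add]
    have := psh_D2 φ (T ζ) (ξ, (ε:ℂ) * b) hφ2 (hpsh _ hTU _)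
    rw [one_smul]
    positivity
  · have h := hexp _ _ (h1.trans_le (min_le_left _ _)) (h2.trans_le (min_le_left _ _)) hTU
    have h3 := (Complex.abs_re_le_norm _).trans h
    have h4 : ∀ x y : ℂ, ((starRingEnd ℂ x) * (starRingEnd ℂ y) ^ n).re = (x * y ^ n).re := by
      intro x y
      rw [← map_pow, ← map_mul, Complex.conj_re]
    have h5 : (φn0 (z₀ + ζ • ξ) * ((ε:ℂ) * (w + ζ * b)) ^ n).re =
        ε ^ n * (φn0 (z₀ + ζ • ξ) * (w + ζ * b) ^ n).re := by
      rw [← Complex.re_ofReal_mul]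
      congr 1
      rw [mul_pow]
      push_cast
      ring
    have h6 := qpoly_hom n A ε (w + ζ * b)
    rw [Complex.sub_re, Complex.add_re, Complex.add_re, h4, h5, Complex.ofReal_re, h2'] at h3
    change |φ (T ζ) - (qpoly n A ((ε:ℂ) * (w + ζ * b)) + _ + _)| ≤ _ at h3
    rw [h6] at h3
    have hεn : 0 < ε ^ n := by positivity
    have h7 : (ε ^ n)⁻¹ * φ (T ζ) - gfun n A φn0 z₀ ξ w b ζ =
        (ε ^ n)⁻¹ * (φ (T ζ) - (ε ^ n * qpoly n A (w + ζ * b) +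
          ε ^ n * (φn0 (z₀ + ζ • ξ) * (w + ζ * b) ^ n).re +
          ε ^ n * (φn0 (z₀ + ζ • ξ) * (w + ζ * b) ^ n).re)) := by
      unfold gfun
      field_simp
      ring
    change |(ε ^ n)⁻¹ * φ (T ζ) - gfun n A φn0 z₀ ξ w b ζ| ≤ η
    rw [h7, abs_mul, abs_of_pos (inv_pos.2 hεn)]
    calc _ ≤ (ε ^ n)⁻¹ * (C * (ε * ‖w + ζ * b‖) ^ (n + 1)) := by gcongr
      _ ≤ (ε ^ n)⁻¹ * (C * (ε * M) ^ (n + 1)) := by gcongr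
      _ = C * ε * M ^ (n + 1) := by rw [mul_pow, pow_succ ε]; field_simp
      _ ≤ η := hε2

theorem dbar_zero (hn : 2 ≤ n) (hφ : ContDiff ℝ 2 φn0)
    (happ : ∃ ρ₀ > (0:ℝ), ∀ w b : ℂ, ∀ η > (0:ℝ), ∃ F : ℂ → ℝ, ∀ ζ : ℂ, ‖ζ‖ ≤ ρ₀ →
      ContDiffAt ℝ 2 F ζ ∧
      0 ≤ D2 F ζ 1 + D2 F ζ Complex.I ∧ |F ζ - gfun n A φn0 z₀ ξ w b ζ| ≤ η) :
    fderiv ℝ φn0 z₀ ξ + Complex.I * fderiv ℝ φn0 z₀ (Complex.I • ξ) = 0 := by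
  obtain ⟨ρ₀, hρ₀, happ⟩ := happ
  set c := fderiv ℝ φn0 z₀ ξ + Complex.I * fderiv ℝ φn0 z₀ (Complex.I • ξ) with hc
  by_contra hc0
  have hn0 : (n:ℂ) ≠ 0 := by exact_mod_cast (by omega : n ≠ 0)
  have hg := fun w b => gfun_contDiff n A φn0 z₀ ξ hφ w b
  -- positivity for each direction
  have hpos : ∀ w b : ℂ, 0 ≤ D2 (gfun n A φn0 z₀ ξ w b) 0 1 +
      D2 (gfun n A φn0 z₀ ξ w b) 0 Complex.I :=
    fun w b => limit_subharm _ (hg w b) ρ₀ hρ₀ (happ w b)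
  set ω : ℂ := Complex.exp ((Real.pi / n : ℝ) * Complex.I) with hω
  have hωn : ω ^ n = -1 := by
    rw [hω, ← Complex.exp_nat_mul, ← Complex.exp_pi_mul_I]
    congr 1
    push_cast
    field_simp
  have hω1 : ω ^ (n - 1) * (starRingEnd ℂ ω) ^ (n - 1) = 1 := by
    rw [← mul_pow, Complex.mul_conj, Complex.normSq_eq_norm_sq, hω, Complex.norm_exp_ofReal_mul_I]
    simp
  set K : ℂ → ℂ → ℝ := fun w b => D2 (qpoly n A) w b + D2 (qpoly n A) w (Complex.I * b) with hK
  have hKs : ∀ (w b : ℂ) (s : ℝ), K w (s * b) = s ^ 2 * K w b := by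
    intro w b s
    have h1 : (s:ℂ) * b = s • b := by simp
    have h2 : Complex.I * (s • b) = s • (Complex.I * b) := by simp; ring
    simp only [hK]
    rw [h1, h2, D2_smul s b (qpoly_contDiff n A).contDiffAt,
      D2_smul s _ (qpoly_contDiff n A).contDiffAt, smul_eq_mul, smul_eq_mul]
    ring
  set b₁ : ℂ := -(starRingEnd ℂ c) with hb₁
  set b₂ : ℂ := -(starRingEnd ℂ c) * (starRingEnd ℂ ω) ^ (n - 1) with hb₂
  have hfin : ∀ s : ℝ, 0 ≤ s ^ 2 * (K 1 b₁ + K ω b₂) - 8 * n * s * ‖c‖ ^ 2 := by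
    intro s
    have p1 := hpos 1 (s * b₁)
    have p2 := hpos ω (s * b₂)
    rw [gfun_lap n A φn0 z₀ ξ hφ] at p1 p2
    have e1 : (1:ℂ) ^ (n - 1) * (s * b₁) * c = ((-(s * ‖c‖ ^ 2) : ℝ) : ℂ) := by
      have := Complex.mul_conj c
      rw [Complex.normSq_eq_norm_sq] at this
      push_cast at this ⊢
      rw [← this, hb₁]
      ring
    have e2 : ω ^ (n - 1) * (s * b₂) * c = ((-(s * ‖c‖ ^ 2) : ℝ) : ℂ) := by
      have := Complex.mul_conj c
      rw [Complex.normSq_eq_norm_sq] at this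
      push_cast at this ⊢
      rw [← this, hb₂]
      linear_combination (-s * c * (starRingEnd ℂ c)) * hω1
    rw [← hc, e1, one_pow] at p1
    rw [← hc, e2, hωn] at p2
    have k1 := hKs 1 b₁ s
    have k2 := hKs ω b₂ s
    simp only [hK] at k1 k2 ⊢
    rw [k1] at p1
    rw [k2] at p2
    have e3 : (2 * (n:ℂ) * ((-(s * ‖c‖ ^ 2) : ℝ) : ℂ)).re = -(2 * n * (s * ‖c‖ ^ 2)) := by
      have : (2 * (n:ℂ) * ((-(s * ‖c‖ ^ 2) : ℝ) : ℂ)) = ((-(2 * n * (s * ‖c‖ ^ 2)) : ℝ) : ℂ) := by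
        push_cast; ring
      rw [this, Complex.ofReal_re]
    rw [Complex.add_re, e3] at p1 p2
    rw [mul_one] at p1
    rw [mul_neg_one, Complex.neg_re] at p2
    linarith
  set K₀ := K 1 b₁ + K ω b₂
  have hcn : 0 < 8 * (n:ℝ) * ‖c‖ ^ 2 := by
    have : 0 < (n:ℝ) := by exact_mod_cast (by omega : 0 < n)
    have : 0 < ‖c‖ := norm_pos_iff.2 hc0
    positivity
  set m := 8 * (n:ℝ) * ‖c‖ ^ 2 with hm
  have h := hfin (m / (2 * (|K₀| + 1)))
  have hs : 0 < m / (2 * (|K₀| + 1)) := by positivity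
  set s := m / (2 * (|K₀| + 1)) with hsd
  have hsK : s * (|K₀| + 1) = m / 2 := by rw [hsd]; field_simp
  have h1 : 0 ≤ s * (s * K₀ - m) := by rw [hm]; linarith
  have h2 : 0 ≤ s * K₀ - m := nonneg_of_mul_nonneg_right h1 hs
  have h3 : s * K₀ ≤ s * (|K₀| + 1) := by gcongr; linarith [le_abs_self K₀]
  linarith

end
/-- If `φ(z,w) = ∑_{p,q>0, p+q=n} A^{(p,q)} w^p conj(w)^q + φ^{(n,0)}(z) w^n
+ conj(φ^{(n,0)}(z)) conj(w)^n + O(|w|^{n+1})` is smooth and plurisubharmonic, with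
non-negative constants `A^{(p,q)}`, then `φ^{(n,0)}` is holomorphic in `z`. -/
theorem stmt13 {d : ℕ} (U : Set ((Fin d → ℂ) × ℂ)) (hU : IsOpen U)
    (n : ℕ) (hn : 2 ≤ n)
    (A : ℕ → ℝ) (hA : ∀ p, 0 ≤ A p)
    (φ : (Fin d → ℂ) × ℂ → ℝ) (hsm : ContDiffOn ℝ (⊤ : ℕ∞) φ U) (hpsh : PSHOn φ U)
    (φn0 : (Fin d → ℂ) → ℂ) (hφn0 : ContDiff ℝ (⊤ : ℕ∞) φn0)
    (hexp : ∀ z₀ : Fin d → ℂ, (z₀, (0 : ℂ)) ∈ U →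
      ∃ C > (0 : ℝ), ∃ r > (0 : ℝ), ∀ (z : Fin d → ℂ) (w : ℂ),
        ‖z - z₀‖ < r → ‖w‖ < r → (z, w) ∈ U →
        ‖(φ (z, w) : ℂ) -
            (∑ p ∈ Finset.Ioo 0 n, (A p : ℂ) * w ^ p * (starRingEnd ℂ w) ^ (n - p)
              + φn0 z * w ^ n + (starRingEnd ℂ (φn0 z)) * (starRingEnd ℂ w) ^ n)‖
          ≤ C * ‖w‖ ^ (n + 1)) :
    DifferentiableOn ℂ φn0 {z : Fin d → ℂ | (z, (0 : ℂ)) ∈ U} := by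
  intro z₀ hz
  have hz' : (z₀, (0:ℂ)) ∈ U := hz
  obtain ⟨C, hC, r, hr, hex⟩ := hexp z₀ hz'
  have hφ2 : ContDiff ℝ 2 φn0 := hφn0.of_le two_le_smooth
  have hdb : ∀ ξ, fderiv ℝ φn0 z₀ ξ + Complex.I * fderiv ℝ φn0 z₀ (Complex.I • ξ) = 0 :=
    fun ξ => dbar_zero n A φn0 z₀ ξ hn hφ2
      (approx n A φn0 z₀ ξ U hU φ hsm hpsh hz' C hC r hr hex)
  have hI : ∀ ξ, fderiv ℝ φn0 z₀ (Complex.I • ξ) = Complex.I * fderiv ℝ φn0 z₀ ξ := by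
    intro ξ
    linear_combination (-Complex.I) * hdb ξ + fderiv ℝ φn0 z₀ (Complex.I • ξ) * Complex.I_sq
  have hd := hφ2.differentiable (by norm_num) z₀
  refine DifferentiableAt.differentiableWithinAt ?_
  rw [differentiableAt_iff_restrictScalars ℝ hd]
  refine ⟨{ toFun := fderiv ℝ φn0 z₀, map_add' := fun x y => map_add _ x y,
            map_smul' := ?_, cont := (fderiv ℝ φn0 z₀).continuous }, ?_⟩
  · intro a x
    have : a • x = a.re • x + a.im • (Complex.I • x) := by
      conv_lhs => rw [← Complex.re_add_im a]
      rw [add_smul, mul_smul, Complex.coe_smul, Complex.coe_smul]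
    rw [this, map_add, map_smul, map_smul, hI]
    simp only [RingHom.id_apply, smul_eq_mul, Complex.real_smul]
    conv_rhs => rw [← Complex.re_add_im a]
    ring
  · ext x
    rfl
end
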